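/- arXiv:1401.5833 — 5 statements merged into one kernel-verified Lean document; each statement's English description precedes it below -/
import Mathlib

section
/- Let Y be a symmetric d×d real matrix with operator norm ‖Y‖ ≤ q < 1 and let X be an arbitrary m×d real matrix. Then the d-dimensional parallelotope volume of the (d+m)×d matrix whose top block is I+Y and bottom block is X satisfies Vol([I+Y; X]) ≤ (1+q)^d · Vol([I; X]), where for a matrix A with columns a₁,…,a_d, Vol(A) denotes the volume of the parallelotope spanned by its columns, i.e. sqrt(det(AᵀA)). -/
lemma aux_det_one_add {n : ℕ} (Q : Matrix (Fin n) (Fin n) ℝ) (hQ : Q.PosSemidef) :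
    1 ≤ (1 + Q).det := by
  have hH : (1 + Q).IsHermitian := Matrix.isHermitian_one.add hQ.1
  rw [hH.det_eq_prod_eigenvalues]
  simp only [RCLike.ofReal_real_eq_id, id]
  suffices h : ∀ i, 1 ≤ hH.eigenvalues i by
    calc (1 : ℝ) = ∏ i : Fin n, (1 : ℝ) := by simp
      _ ≤ _ := Finset.prod_le_prod (fun _ _ => zero_le_one) (fun i _ => h i)
  intro i
  have h1 := hH.mulVec_eigenvectorBasis i
  set v : EuclideanSpace ℝ (Fin n) := hH.eigenvectorBasis i with hv
  have hn : ‖v‖ = 1 := hH.eigenvectorBasis.orthonormal.1 i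
  have hvv : (v : Fin n → ℝ) ⬝ᵥ (v : Fin n → ℝ) = 1 := by
    have := EuclideanSpace.real_norm_sq_eq v
    rw [hn] at this
    simp only [dotProduct, ← sq]
    linarith
  have h2 := hQ.dotProduct_mulVec_nonneg (v : Fin n → ℝ)
  have h3 := congrArg (fun w => (v : Fin n → ℝ) ⬝ᵥ w) h1
  simp only [Matrix.add_mulVec, Matrix.one_mulVec, dotProduct_add, dotProduct_smul, hvv] at h3
  simp at h2 h3
  linarith

lemma aux_det_mono {n : ℕ} (A B : Matrix (Fin n) (Fin n) ℝ) (hA : A.PosSemidef)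
    (hAB : (B - A).PosSemidef) : A.det ≤ B.det := by
  have hB : B.PosSemidef := by simpa using hA.add hAB
  by_cases h0 : A.det = 0
  · rw [h0]; exact hB.det_nonneg
  obtain ⟨C, hC⟩ : ∃ C : Matrix (Fin n) (Fin n) ℝ, A = C.conjTranspose * C :=
    by open scoped MatrixOrder in exact CStarAlgebra.nonneg_iff_eq_star_mul_self.1 hA.nonneg
  have hCd : IsUnit C.det := by
    rw [isUnit_iff_ne_zero]
    intro h
    apply h0
    rw [hC, Matrix.det_mul, h, mul_zero]
  have hQ := hAB.conjTranspose_mul_mul_same C⁻¹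
  have h1 := aux_det_one_add _ hQ
  have hCC : C⁻¹ * C = 1 := Matrix.nonsing_inv_mul C hCd
  have hCC' : C.conjTranspose * (C⁻¹).conjTranspose = 1 := by
    rw [← Matrix.conjTranspose_mul, hCC, Matrix.conjTranspose_one]
  have e : B = C.conjTranspose * (1 + (C⁻¹).conjTranspose * (B - A) * C⁻¹) * C := by
    have : C.conjTranspose * (1 + (C⁻¹).conjTranspose * (B - A) * C⁻¹) * C
      = C.conjTranspose * C + (C.conjTranspose * (C⁻¹).conjTranspose) * (B - A) * (C⁻¹ * C) := by
      noncomm_ring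
    rw [this, hCC, hCC', ← hC]; simp
  have e2 : B.det = A.det * (1 + (C⁻¹).conjTranspose * (B - A) * C⁻¹).det := by
    conv_lhs => rw [e]
    have hd : A.det = C.conjTranspose.det * C.det := by rw [hC, Matrix.det_mul]
    rw [Matrix.det_mul, Matrix.det_mul, hd]; ring
  rw [e2]
  exact le_mul_of_one_le_right hA.det_nonneg h1

lemma aux_norm {n k : ℕ} (M : Matrix (Fin k) (Fin n) ℝ) (x : Fin n → ℝ) :
    x ⬝ᵥ ((M.transpose * M).mulVec x) = ‖WithLp.toLp 2 (M.mulVec x)‖ ^ 2 := by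
  rw [EuclideanSpace.real_norm_sq_eq, ← Matrix.mulVec_mulVec, Matrix.dotProduct_mulVec,
    Matrix.vecMul_transpose]
  simp [dotProduct, sq]



open scoped Matrix

noncomputable section

/-- The volume of the parallelotope spanned by the columns of `A`, i.e. `sqrt (det (AᵀA))`. -/
def pvol {k l : Type*} [Fintype k] [Fintype l] [DecidableEq l] (A : Matrix k l ℝ) : ℝ :=
  Real.sqrt (Aᵀ * A).det

/-- The operator norm of a matrix, viewed as a linear map between Euclidean spaces. -/
def matOpNorm {k l : ℕ} (A : Matrix (Fin k) (Fin l) ℝ) : ℝ :=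
  ‖LinearMap.toContinuousLinearMap (Matrix.toEuclideanLin A)‖

/-- If `Y` is a symmetric `d × d` matrix with operator norm `‖Y‖ ≤ q < 1` and
`X` is an arbitrary `m × d` matrix, then
`Vol([I + Y; X]) ≤ (1 + q)^d · Vol([I; X])`. -/
theorem pvol_perturbation_upper {d m : ℕ} (q : ℝ) (hq : q < 1)
    (Y : Matrix (Fin d) (Fin d) ℝ) (hY : Y.IsSymm) (hYq : matOpNorm Y ≤ q)
    (X : Matrix (Fin m) (Fin d) ℝ) :
    pvol (Matrix.fromRows ((1 : Matrix (Fin d) (Fin d) ℝ) + Y) X) ≤ (1 + q) ^ d * pvol (Matrix.fromRows (1 : Matrix (Fin d) (Fin d) ℝ) X) := by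
  have hq0 : 0 ≤ q := le_trans (norm_nonneg _) hYq
  unfold pvol
  have hP : ∀ Z : Matrix (Fin d) (Fin d) ℝ,
      ((Matrix.fromRows Z X)ᵀ * Matrix.fromRows Z X) = Zᵀ * Z + Xᵀ * X := by
    intro Z
    rw [Matrix.transpose_fromRows, Matrix.fromCols_mul_fromRows]
  have hS : ∀ {k : ℕ} (Z : Matrix (Fin k) (Fin d) ℝ), (Zᵀ * Z).PosSemidef := by
    intro k Z
    simpa using Matrix.posSemidef_conjTranspose_mul_self Z
  rw [hP, hP]
  have hc : (0:ℝ) ≤ (1 + q) ^ d := by positivity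
  rw [← Real.sqrt_sq hc, ← Real.sqrt_mul (sq_nonneg _)]
  apply Real.sqrt_le_sqrt
  have e : ((1 + q) ^ d) ^ 2 * ((1 : Matrix (Fin d) (Fin d) ℝ)ᵀ * 1 + Xᵀ * X).det
      = ((1 + q) ^ 2 • ((1 : Matrix (Fin d) (Fin d) ℝ)ᵀ * 1 + Xᵀ * X)).det := by
    rw [Matrix.det_smul, Fintype.card_fin, ← pow_mul, ← pow_mul, mul_comm d 2]
  rw [e]
  apply aux_det_mono _ _ ((hS _).add (hS _))
  refine Matrix.PosSemidef.of_dotProduct_mulVec_nonneg ?_ ?_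
  · exact (((hS _).add (hS _)).1.smul (IsSelfAdjoint.all _)).sub ((hS _).add (hS _)).1
  intro x
  simp only [Matrix.sub_mulVec, Matrix.smul_mulVec, Matrix.add_mulVec (Matrix.transpose _ * _),
    star_trivial, dotProduct_sub, dotProduct_smul, dotProduct_add, aux_norm, smul_eq_mul]
  have h1 : ‖WithLp.toLp 2 ((1 + Y).mulVec x)‖ ≤ (1 + q) * ‖WithLp.toLp 2 x‖ := by
    rw [Matrix.add_mulVec, Matrix.one_mulVec, WithLp.toLp_add]
    have h2 : ‖WithLp.toLp 2 (Y.mulVec x)‖ ≤ q * ‖WithLp.toLp 2 x‖ := by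
      have := (LinearMap.toContinuousLinearMap (Matrix.toEuclideanLin Y)).le_opNorm
        (WithLp.toLp 2 x)
      exact this.trans (mul_le_mul_of_nonneg_right hYq (norm_nonneg _))
    have := norm_add_le (WithLp.toLp 2 x) (WithLp.toLp 2 (Y.mulVec x))
    linarith
  rw [Matrix.one_mulVec]
  have h3 := pow_le_pow_left₀ (norm_nonneg _) h1 2
  rw [mul_pow] at h3
  have h4 := sq_nonneg ‖WithLp.toLp 2 (X.mulVec x)‖
  nlinarith [mul_nonneg (by positivity : 0 ≤ 2 * q + q ^ 2) h4]

end
end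

section
/- Let Y be a symmetric d×d real matrix with operator norm ‖Y‖ ≤ q < 1 and let X be an arbitrary m×d real matrix. Then the absolute determinant of the (d+m)×(d+m) block matrix [[I+Y, Xᵀ],[X, −I]] is at least (1−q)^d times the absolute determinant of [[I, Xᵀ],[X, −I]]; equivalently, Vol([[I+Y, Xᵀ],[X, −I]]) ≥ (1−q)^d · Vol([[I, Xᵀ],[X, −I]]), where Vol of a square matrix is the absolute value of its determinant. -/
open scoped Matrix

noncomputable section

theorem one_le_det_one_add {n : ℕ} (S : Matrix (Fin n) (Fin n) ℝ) (hS : S.PosSemidef) :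
    1 ≤ (1 + S).det := by
  have h := congrArg (Polynomial.eval (-1)) hS.1.charpoly_eq
  rw [Matrix.eval_charpoly, Polynomial.eval_prod] at h
  have e : Matrix.scalar (Fin n) (-1 : ℝ) - S = -(1 + S) := by
    rw [map_neg, map_one]; abel
  have e2 : ∏ i, Polynomial.eval (-1 : ℝ) (Polynomial.X - Polynomial.C ((hS.1.eigenvalues i : ℝ)))
      = (-1) ^ n * ∏ i, (1 + hS.1.eigenvalues i) := by
    have : ∀ i, Polynomial.eval (-1 : ℝ) (Polynomial.X - Polynomial.C ((hS.1.eigenvalues i : ℝ)))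
      = (-1) * (1 + hS.1.eigenvalues i) := by intro i; simp; ring
    simp_rw [this, Finset.prod_mul_distrib]
    simp
  rw [e, Matrix.det_neg, Fintype.card_fin] at h
  have h2 : (-1 : ℝ) ^ n * (1 + S).det = (-1) ^ n * ∏ i, (1 + hS.1.eigenvalues i) := h.trans e2
  rw [mul_left_cancel₀ (pow_ne_zero n (by norm_num)) h2]
  exact Finset.one_le_prod fun i _ => by linarith [hS.eigenvalues_nonneg i]

open scoped MatrixOrder Matrix.Norms.L2Operator in
theorem det_le_det_add {n : ℕ} (A R : Matrix (Fin n) (Fin n) ℝ) (hA : A.PosDef)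
    (hR : R.PosSemidef) : A.det ≤ (A + R).det := by
  obtain ⟨C, rfl⟩ := CStarAlgebra.nonneg_iff_eq_star_mul_self.mp hR.nonneg
  rw [Matrix.star_eq_conjTranspose]
  have hu : IsUnit A.det := hA.det_pos.ne'.isUnit
  rw [Matrix.det_add_mul _ _ hu]
  have := one_le_det_one_add _ (hA.inv.posSemidef.mul_mul_conjTranspose_same C)
  nlinarith [hA.det_pos]

theorem abs_det_block {d m : ℕ} (A : Matrix (Fin d) (Fin d) ℝ) (X : Matrix (Fin m) (Fin d) ℝ) :
    |(Matrix.fromBlocks A Xᵀ X (-1 : Matrix (Fin m) (Fin m) ℝ)).det| = |(A + Xᵀ * X).det| := by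
  have e : Matrix.fromBlocks A Xᵀ X (-1 : Matrix (Fin m) (Fin m) ℝ) =
     Matrix.fromBlocks A (-Xᵀ) X 1 * Matrix.fromBlocks 1 0 0 (-1) := by
    simp [Matrix.fromBlocks_multiply]
  rw [e, Matrix.det_mul, Matrix.det_fromBlocks_one₂₂, Matrix.det_fromBlocks_zero₂₁, abs_mul]
  simp [Matrix.det_neg]

theorem posSemidef_aux {d : ℕ} (q : ℝ) (Y : Matrix (Fin d) (Fin d) ℝ) (hY : Y.IsSymm)
    (hYq : matOpNorm Y ≤ q) : (q • (1 : Matrix (Fin d) (Fin d) ℝ) + Y).PosSemidef := by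
  refine Matrix.PosSemidef.of_dotProduct_mulVec_nonneg ?_ ?_
  · simp [Matrix.IsHermitian, hY.eq]
  intro x
  set v : EuclideanSpace ℝ (Fin d) := WithLp.toLp 2 x
  have h1 := (LinearMap.toContinuousLinearMap (Matrix.toEuclideanLin Y)).le_opNorm v
  have h2 := abs_real_inner_le_norm v (LinearMap.toContinuousLinearMap (Matrix.toEuclideanLin Y) v)
  have h3 : inner ℝ v (LinearMap.toContinuousLinearMap (Matrix.toEuclideanLin Y) v)
      = x ⬝ᵥ (Y *ᵥ x) := by
    simp [v, EuclideanSpace.inner_eq_star_dotProduct, dotProduct_comm]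
  have h4 : ‖v‖ * ‖v‖ = x ⬝ᵥ x := by
    rw [← real_inner_self_eq_norm_mul_norm]
    rw [EuclideanSpace.inner_eq_star_dotProduct]; simp [v]
  change _ ≤ matOpNorm Y * _ at h1
  have h5 := neg_le_of_abs_le h2
  rw [h3] at h5
  have h6 := mul_le_mul_of_nonneg_left h1 (norm_nonneg v)
  have h7 := mul_le_mul_of_nonneg_right hYq (mul_self_nonneg ‖v‖)
  have : star x ⬝ᵥ ((q • (1 : Matrix (Fin d) (Fin d) ℝ) + Y) *ᵥ x)
      = q * (x ⬝ᵥ x) + x ⬝ᵥ (Y *ᵥ x) := by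
    simp [Matrix.add_mulVec, Matrix.smul_mulVec, dotProduct_add]
  rw [this, ← h4]
  nlinarith

/-- If `Y` is a symmetric `d × d` matrix with operator norm `‖Y‖ ≤ q < 1` and
`X` is an arbitrary `m × d` matrix, then
`|det [[I+Y, Xᵀ],[X, −I]]| ≥ (1 − q)^d · |det [[I, Xᵀ],[X, −I]]|`. -/
theorem absDet_perturbation_lower {d m : ℕ} (q : ℝ) (hq : q < 1)
    (Y : Matrix (Fin d) (Fin d) ℝ) (hY : Y.IsSymm) (hYq : matOpNorm Y ≤ q)
    (X : Matrix (Fin m) (Fin d) ℝ) :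
    (1 - q) ^ d *
        |(Matrix.fromBlocks (1 : Matrix (Fin d) (Fin d) ℝ) Xᵀ X
            (-1 : Matrix (Fin m) (Fin m) ℝ)).det| ≤
      |(Matrix.fromBlocks ((1 : Matrix (Fin d) (Fin d) ℝ) + Y) Xᵀ X
          (-1 : Matrix (Fin m) (Fin m) ℝ)).det| := by
  rw [abs_det_block, abs_det_block]
  have hq0 : 0 ≤ q := (norm_nonneg _).trans hYq
  have hX : (Xᵀ * X).PosSemidef := by
    simpa using Matrix.posSemidef_conjTranspose_mul_self X
  have hP : (1 + Xᵀ * X).PosDef := Matrix.PosDef.one.add_posSemidef hX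
  have hA := hP.smul (sub_pos.mpr hq)
  have hR := (posSemidef_aux q Y hY hYq).add (hX.smul hq0)
  have key := det_le_det_add _ _ hA hR
  have e : (1 - q) • (1 + Xᵀ * X) + (q • (1 : Matrix (Fin d) (Fin d) ℝ) + Y + q • (Xᵀ * X))
      = 1 + Y + Xᵀ * X := by module
  rw [e, Matrix.det_smul, Fintype.card_fin] at key
  rw [abs_of_pos hP.det_pos]
  exact key.trans (le_abs_self _)

end
end

section
/- Let M be a C² compact d-dimensional submanifold of ℝ^D without boundary with reach τ > 0. Suppose y ∈ M, η ∈ T_y⊥M with ‖η‖ = 1, and z ∈ B(y,r) ∩ M, where r ≤ τ/2. Then |⟨η, z − y⟩| ≤ 2r²/τ. -/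
open MeasureTheory ProbabilityTheory Metric
open scoped ENNReal RealInnerProductSpace BigOperators Classical Matrix

noncomputable section

abbrev Euc (D : ℕ) := EuclideanSpace ℝ (Fin D)

/-- The open tube of radius `r` around a set `M ⊆ ℝ^D`. -/
def tube {D : ℕ} (M : Set (Euc D)) (r : ℝ) : Set (Euc D) := {y | Metric.infDist y M < r}

/-- The reach of a set `M ⊆ ℝ^D`: the supremum of all `r ≥ 0` such that every point of the
open `r`-tube around `M` has a unique nearest point in `M`. -/
def reach {D : ℕ} (M : Set (Euc D)) : ℝ :=
  sSup {r : ℝ | 0 ≤ r ∧ ∀ y ∈ tube M r, ∃! x, x ∈ M ∧ dist y x = Metric.infDist y M}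

/-- A compact `C²` `d`-dimensional embedded submanifold of `ℝ^D` without boundary, encoded by
the property of being locally the graph of a `C²` map over its tangent space, starting with
zero value and zero derivative at the base point. `tangentAt y` is the tangent space at `y`
(translated to the origin, i.e. viewed as a linear subspace of `ℝ^D`). -/
structure C2CompactSubmanifold (D d : ℕ) where
  carrier : Set (Euc D)
  nonempty : carrier.Nonempty
  isCompact : IsCompact carrier
  tangentAt : Euc D → Submodule ℝ (Euc D)
  finrank_tangent : ∀ y ∈ carrier, Module.finrank ℝ (tangentAt y) = d
  locally_graph : ∀ y ∈ carrier, ∃ ε > 0,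
    ∃ f : tangentAt y → ((tangentAt y)ᗮ : Submodule ℝ (Euc D)),
      ContDiff ℝ 2 f ∧ f 0 = 0 ∧ fderiv ℝ f 0 = 0 ∧
        carrier ∩ ball y ε =
          (Set.range fun v : tangentAt y => y + (v : Euc D) + (f v : Euc D)) ∩ ball y ε

/-- Every point at distance less than the reach has a unique nearest point. -/
lemma unique_nearest_of_lt_reach {D : ℕ} {K : Set (Euc D)} {p : Euc D}
    (h : Metric.infDist p K < reach K) :
    ∃! x, x ∈ K ∧ dist p x = Metric.infDist p K := by
  unfold reach at h
  obtain ⟨r, hr, hlt⟩ := exists_lt_of_lt_csSup (by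
    refine ⟨0, le_refl _, fun y hy => ?_⟩
    exact absurd (show Metric.infDist y K < 0 from hy) (not_lt.2 Metric.infDist_nonneg)) h
  exact hr.2 p hlt

/-- First order condition at a maximiser of the distance function over a convex set. -/
lemma first_order {D : ℕ} {K : Set (Euc D)} (hK : IsCompact K) (hne : K.Nonempty)
    {C : Set (Euc D)} (hC : Convex ℝ C) {q : Euc D} (hq : q ∈ C)
    (hmax : ∀ q' ∈ C, Metric.infDist q' K ≤ Metric.infDist q K)
    {x : Euc D} (hx : ∀ x', x' ∈ K → dist q x' = Metric.infDist q K → x' = x)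
    {q' : Euc D} (hq' : q' ∈ C) : ⟪q' - q, q - x⟫ ≤ 0 := by
  set w := q' - q with hw
  set l : ℕ → ℝ := fun k => 1 / ((k : ℝ) + 1) with hl
  have hlpos : ∀ k, 0 < l k := fun k => Nat.one_div_pos_of_nat
  have hl1 : ∀ k, l k ≤ 1 := fun k => by
    simp only [hl]; rw [div_le_one (by positivity)]; linarith [(Nat.cast_nonneg k : (0:ℝ) ≤ k)]
  have hlt : Filter.Tendsto l Filter.atTop (nhds 0) := tendsto_one_div_add_atTop_nhds_zero_nat
  have hmem : ∀ k, q + l k • w ∈ C := fun k =>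
    hC.add_smul_sub_mem hq hq' ⟨(hlpos k).le, hl1 k⟩
  choose X hXK hX using fun k => hK.exists_infDist_eq_dist hne (q + l k • w)
  have hineq : ∀ k, 2 * ⟪w, q - X k⟫ + l k * ‖w‖ ^ 2 ≤ 0 := by
    intro k
    have h1 : ‖(q - X k) + l k • w‖ ≤ ‖q - X k‖ := by
      have e : (q - X k) + l k • w = (q + l k • w) - X k := by abel
      rw [e, ← dist_eq_norm, ← dist_eq_norm, ← hX k]
      exact (hmax _ (hmem k)).trans (Metric.infDist_le_dist_of_mem (hXK k))
    have h2 : ‖(q - X k) + l k • w‖ ^ 2 ≤ ‖q - X k‖ ^ 2 := by gcongr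
    rw [norm_add_sq_real, norm_smul, inner_smul_right, real_inner_comm, mul_pow,
      Real.norm_eq_abs, sq_abs] at h2
    have := hlpos k
    by_contra hcon
    push Not at hcon
    have := mul_pos this hcon
    nlinarith
  obtain ⟨x0, hx0, φ, hφ, hlim⟩ := hK.tendsto_subseq hXK
  have hl2 : Filter.Tendsto (fun k => l (φ k)) Filter.atTop (nhds 0) :=
    hlt.comp hφ.tendsto_atTop
  have hql : Filter.Tendsto (fun k => q + l (φ k) • w) Filter.atTop (nhds q) := by
    simpa using (tendsto_const_nhds (x := q)).add (hl2.smul_const w)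
  have e1 : Filter.Tendsto (fun k => dist (q + l (φ k) • w) (X (φ k))) Filter.atTop
      (nhds (dist q x0)) := hql.dist hlim
  have e2 : Filter.Tendsto (fun k => dist (q + l (φ k) • w) (X (φ k))) Filter.atTop
      (nhds (Metric.infDist q K)) := by
    have := ((Metric.continuous_infDist_pt K).tendsto q).comp hql
    refine this.congr fun k => ?_
    exact hX (φ k)
  have hx0x : x0 = x := hx x0 hx0 (tendsto_nhds_unique e1 e2)
  subst hx0x
  have e3 : Filter.Tendsto (fun k => 2 * ⟪w, q - X (φ k)⟫ + l (φ k) * ‖w‖ ^ 2) Filter.atTop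
      (nhds (2 * ⟪w, q - x0⟫ + 0 * ‖w‖ ^ 2)) := by
    refine Filter.Tendsto.add ?_ (hl2.mul_const _)
    refine Filter.Tendsto.const_mul _ ?_
    exact Filter.Tendsto.inner tendsto_const_nhds (tendsto_const_nhds.sub hlim)
  have := le_of_tendsto' e3 fun k => hineq (φ k)
  linarith

/-- The condition that the ball of radius `t` centred at `y + t η` misses `K`. -/
lemma dist_iff {D : ℕ} {y η x : Euc D} (hη1 : ‖η‖ = 1) {t : ℝ} (ht : 0 ≤ t) :
    t ≤ dist (y + t • η) x ↔ 2 * t * ⟪η, x - y⟫ ≤ ‖x - y‖ ^ 2 := by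
  have e : dist (y + t • η) x = ‖t • η - (x - y)‖ := by
    rw [dist_eq_norm]; congr 1; abel
  have e2 : ‖t • η - (x - y)‖ ^ 2 = t ^ 2 - 2 * t * ⟪η, x - y⟫ + ‖x - y‖ ^ 2 := by
    rw [norm_sub_sq_real, norm_smul, inner_smul_left, mul_pow, hη1, Real.norm_eq_abs, sq_abs]
    simp; ring
  rw [e, ← sq_le_sq₀ ht (norm_nonneg _), e2]
  constructor <;> intro h <;> linarith

lemma doubling {D : ℕ} {K : Set (Euc D)} (hK : IsCompact K) {y η : Euc D} (hy : y ∈ K)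
    (hη1 : ‖η‖ = 1) {s : ℝ} (hs : 0 < s) (h2s : 2 * s < reach K)
    (h : ∀ x ∈ K, s ≤ dist (y + s • η) x) :
    ∀ x ∈ K, 2 * s ≤ dist (y + (2 * s) • η) x := by
  have hne : K.Nonempty := ⟨y, hy⟩
  set p := y + s • η with hp
  have hpy : dist p y = s := by
    rw [dist_eq_norm, hp, add_sub_cancel_left, norm_smul, hη1, Real.norm_of_nonneg hs.le, mul_one]
  have hdp : Metric.infDist p K = s := by
    apply le_antisymm
    · rw [← hpy]; exact Metric.infDist_le_dist_of_mem hy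
    · exact (Metric.le_infDist hne).2 fun {x} hx => h x hx
  obtain ⟨q, hq, hmax⟩ := (isCompact_closedBall p s).exists_isMaxOn
    ⟨p, Metric.mem_closedBall_self hs.le⟩ (Metric.continuous_infDist_pt K).continuousOn
  have hmax' : ∀ q' ∈ closedBall p s, Metric.infDist q' K ≤ Metric.infDist q K := fun q' hq' =>
    hmax hq'
  have hqs : s ≤ Metric.infDist q K := by
    rw [← hdp]; exact hmax' p (Metric.mem_closedBall_self hs.le)
  have hqp : dist q p ≤ s := hq
  have hq2 : Metric.infDist q K ≤ 2 * s := by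
    have := Metric.infDist_le_infDist_add_dist (s := K) (x := q) (y := p)
    linarith
  obtain ⟨x, ⟨hxK, hxd⟩, hxu⟩ := unique_nearest_of_lt_reach (lt_of_le_of_lt hq2 h2s)
  set δ := Metric.infDist q K with hδ
  have hδpos : 0 < δ := lt_of_lt_of_le hs hqs
  have hqx : ‖q - x‖ = δ := by rw [← dist_eq_norm]; exact hxd
  set n := δ⁻¹ • (q - x) with hn
  have hn1 : ‖n‖ = 1 := by
    rw [hn, norm_smul, hqx, Real.norm_of_nonneg (by positivity)]
    field_simp
  have hqxn : q - x = δ • n := by rw [hn, smul_smul, mul_inv_cancel₀ hδpos.ne', one_smul]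
  have hmem : p + s • n ∈ closedBall p s := by
    rw [Metric.mem_closedBall, dist_eq_norm, add_sub_cancel_left, norm_smul, hn1,
      Real.norm_of_nonneg hs.le, mul_one]
  have hfo := first_order hK hne (convex_closedBall p s) hq hmax'
    (fun x' h1 h2 => hxu x' ⟨h1, h2⟩) hmem
  rw [hqxn, inner_smul_right] at hfo
  have hfo2 : ⟪p + s • n - q, n⟫ ≤ 0 := by
    by_contra hcon
    push Not at hcon
    nlinarith [mul_pos hδpos hcon]
  have e1 : p + s • n - q = s • n - (q - p) := by abel
  rw [e1, inner_sub_left, inner_smul_left, real_inner_self_eq_norm_sq, hn1] at hfo2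
  simp only [conj_trivial, one_pow, mul_one] at hfo2
  have hqpn : q - p = s • n := by
    rw [← sub_eq_zero, ← norm_eq_zero, ← sq_eq_zero_iff]
    apply le_antisymm _ (sq_nonneg _)
    rw [norm_sub_sq_real, norm_smul, hn1, inner_smul_right, Real.norm_of_nonneg hs.le, mul_one]
    have : ‖q - p‖ ≤ s := by rw [← dist_eq_norm]; exact hqp
    nlinarith [norm_nonneg (q - p)]
  have hpx : p - x = (δ - s) • n := by
    rw [sub_smul, ← hqxn, ← hqpn]; abel
  have hpxd : dist p x = δ - s := by
    rw [dist_eq_norm, hpx, norm_smul, hn1, mul_one, Real.norm_of_nonneg (by linarith)]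
  have hge : s ≤ δ - s := by rw [← hpxd]; exact h x hxK
  have hδ2 : δ = 2 * s := by linarith
  have hxy : x = y := by
    have hu := unique_nearest_of_lt_reach (K := K) (p := p) (by rw [hdp]; linarith)
    exact hu.unique ⟨hxK, by rw [hpxd, hdp]; linarith⟩ ⟨hy, by rw [hpy, hdp]⟩
  have hnη : q = y + (2 * s) • η := by
    have h1 : s • n = s • η := by
      have : δ - s = s := by linarith
      rw [this, hxy, hp, add_sub_cancel_left] at hpx
      exact hpx.symm
    have h2 : q = p + s • n := by rw [← hqpn]; abel
    rw [h2, h1, hp, two_mul, add_smul]; abel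
  intro x' hx'
  rw [← hnη, ← hδ2]
  exact Metric.infDist_le_dist_of_mem hx'

lemma local_step {D d : ℕ} (M : C2CompactSubmanifold D d)
    (y : Euc D) (hy : y ∈ M.carrier)
    (η : Euc D) (hη : η ∈ (M.tangentAt y)ᗮ) (hη1 : ‖η‖ = 1) :
    ∃ C > 0, ∀ x ∈ M.carrier, ⟪η, x - y⟫ ≤ C * ‖x - y‖ ^ 2 := by
  obtain ⟨ε, hε, f, hf, hf0, hf', hgr⟩ := M.locally_graph y hy
  have hd : ContDiff ℝ 1 (fderiv ℝ f) := hf.fderiv_right (by norm_num)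
  obtain ⟨L, U, hU, hL⟩ := (hd.contDiffAt (x := 0)).exists_lipschitzOnWith
  obtain ⟨ρ, hρ, hball⟩ := Metric.mem_nhds_iff.1 hU
  have hquad : ∀ v : M.tangentAt y, ‖v‖ < ρ → ‖f v‖ ≤ L * ‖v‖ ^ 2 := by
    intro v hv
    have hb : ∀ u ∈ closedBall (0 : M.tangentAt y) ‖v‖, ‖fderiv ℝ f u‖ ≤ L * ‖v‖ := by
      intro u hu
      have hu' : ‖u‖ ≤ ‖v‖ := by simpa using hu
      have := hL.dist_le_mul u (hball (by simpa using lt_of_le_of_lt hu' hv)) 0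
        (hball (Metric.mem_ball_self hρ))
      rw [hf', dist_zero_right u] at this
      have h0 : ‖fderiv ℝ f u‖ ≤ L * ‖u‖ := (dist_zero_right (fderiv ℝ f u)).symm.le.trans this
      exact h0.trans (by gcongr)
    have := (convex_closedBall (0 : M.tangentAt y) ‖v‖).norm_image_sub_le_of_norm_fderiv_le
      (𝕜 := ℝ) (fun u _ => (hf.differentiable (by norm_num)).differentiableAt) hb
      (Metric.mem_closedBall_self (norm_nonneg _)) (show v ∈ closedBall 0 ‖v‖ by simp)
    rw [hf0, sub_zero, sub_zero] at this
    linarith [this, sq ‖v‖, mul_assoc (L : ℝ) ‖v‖ ‖v‖]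
  set m := min ε ρ with hm
  have hmpos : 0 < m := lt_min hε hρ
  refine ⟨L + 1 / m, by positivity, fun x hx => ?_⟩
  have hcs : ⟪η, x - y⟫ ≤ ‖x - y‖ := by
    have := real_inner_le_norm η (x - y)
    rwa [hη1, one_mul] at this
  have hLn : 0 ≤ (L : ℝ) * ‖x - y‖ ^ 2 := by positivity
  have hmn : 0 ≤ 1 / m * ‖x - y‖ ^ 2 := by positivity
  rw [add_mul]
  rcases le_or_gt m ‖x - y‖ with hfar | hnear
  · have : ‖x - y‖ ≤ 1 / m * ‖x - y‖ ^ 2 := by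
      rw [one_div, ← div_eq_inv_mul, le_div_iff₀ hmpos]
      nlinarith [norm_nonneg (x - y)]
    linarith
  · have hxb : x ∈ M.carrier ∩ ball y ε :=
      ⟨hx, by rw [Metric.mem_ball, dist_eq_norm]; exact lt_of_lt_of_le hnear (min_le_left _ _)⟩
    rw [hgr] at hxb
    obtain ⟨⟨v, hv⟩, -⟩ := hxb
    have hxy : x - y = (v : Euc D) + (f v : Euc D) := by rw [← hv]; dsimp only; abel
    have horth : ⟪(v : Euc D), (f v : Euc D)⟫ = 0 :=
      (Submodule.mem_orthogonal _ _).1 (f v).2 _ v.2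
    have hηv : ⟪η, (v : Euc D)⟫ = 0 := (Submodule.mem_orthogonal' _ _).1 hη _ v.2
    have hsq : ‖x - y‖ ^ 2 = ‖v‖ ^ 2 + ‖f v‖ ^ 2 := by
      rw [hxy, norm_add_sq_real, horth]; simp
    have hvle : ‖v‖ ^ 2 ≤ ‖x - y‖ ^ 2 := by rw [hsq]; linarith [sq_nonneg ‖f v‖]
    have hvle' : ‖v‖ ≤ ‖x - y‖ := (sq_le_sq₀ (norm_nonneg _) (norm_nonneg _)).1 hvle
    have hq := hquad v (lt_of_le_of_lt hvle' (lt_of_lt_of_le hnear (min_le_right _ _)))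
    have h1 : ⟪η, x - y⟫ ≤ ‖f v‖ := by
      rw [hxy, inner_add_right, hηv, zero_add]
      have := real_inner_le_norm η (f v : Euc D)
      rw [hη1, one_mul] at this
      exact this
    have h2 : (L : ℝ) * ‖v‖ ^ 2 ≤ L * ‖x - y‖ ^ 2 := by gcongr
    linarith

lemma one_sided {D d : ℕ} (M : C2CompactSubmanifold D d) (τ : ℝ)
    (hτ : 0 < τ) (hreach : reach M.carrier = τ)
    (y : Euc D) (hy : y ∈ M.carrier)
    (η : Euc D) (hη : η ∈ (M.tangentAt y)ᗮ) (hη1 : ‖η‖ = 1)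
    (z : Euc D) (hz : z ∈ M.carrier) :
    ⟪η, z - y⟫ ≤ 2 * ‖z - y‖ ^ 2 / τ := by
  obtain ⟨C, hC, hloc⟩ := local_step M y hy η hη hη1
  have hT : 0 < τ / 4 := by positivity
  obtain ⟨N, hN⟩ := pow_unbounded_of_one_lt (2 * C * (τ / 4)) (one_lt_two (α := ℝ))
  set s := τ / 4 / 2 ^ N with hs
  have hspos : 0 < s := by positivity
  have hsC : 2 * s * C ≤ 1 := by
    rw [hs]
    have : 2 * (τ / 4 / 2 ^ N) * C = (2 * C * (τ / 4)) / 2 ^ N := by ring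
    rw [this, div_le_one (by positivity)]
    exact hN.le
  have hind : ∀ k ≤ N, ∀ x ∈ M.carrier, 2 ^ k * s ≤ dist (y + (2 ^ k * s) • η) x := by
    intro k
    induction k with
    | zero =>
      intro _ x hx
      rw [pow_zero, one_mul, dist_iff hη1 hspos.le]
      have h1 := mul_le_mul_of_nonneg_left (hloc x hx) (by positivity : 0 ≤ 2 * s)
      have h2 := mul_le_mul_of_nonneg_right hsC (sq_nonneg ‖x - y‖)
      linarith
    | succ k ih =>
      intro hk
      have hle : (2 : ℝ) ^ (k + 1) * s ≤ τ / 4 := by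
        have h1 : (2 : ℝ) ^ (k + 1) ≤ 2 ^ N := pow_le_pow_right₀ one_le_two hk
        have h2 : (2 : ℝ) ^ N * s = τ / 4 := by rw [hs]; field_simp
        rw [← h2]; gcongr
      have e : (2 : ℝ) ^ (k + 1) * s = 2 * (2 ^ k * s) := by ring
      rw [e] at hle ⊢
      exact doubling M.isCompact hy hη1 (by positivity) (by rw [hreach]; linarith)
        (ih (by omega))
  have hfin := hind N le_rfl z hz
  have h2 : (2 : ℝ) ^ N * s = τ / 4 := by rw [hs]; field_simp
  rw [h2, dist_iff hη1 hT.le] at hfin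
  rw [le_div_iff₀ hτ]
  linarith

/-- If `M` is a `C²` compact `d`-dimensional submanifold of `ℝ^D` without
boundary with reach `τ > 0`, `y ∈ M`, `η` is a unit normal vector at `y`, and
`z ∈ B(y,r) ∩ M` with `r ≤ τ/2`, then `|⟨η, z − y⟩| ≤ 2r²/τ`. -/
theorem normal_deviation_bound {D d : ℕ} (M : C2CompactSubmanifold D d) (τ : ℝ)
    (hτ : 0 < τ) (hreach : reach M.carrier = τ)
    (y : Euc D) (hy : y ∈ M.carrier)
    (η : Euc D) (hη : η ∈ (M.tangentAt y)ᗮ) (hη1 : ‖η‖ = 1)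
    (r : ℝ) (hr : r ≤ τ / 2)
    (z : Euc D) (hz : z ∈ ball y r ∩ M.carrier) :
    |(⟪η, z - y⟫)| ≤ 2 * r ^ 2 / τ := by
  have hzy : ‖z - y‖ < r := by rw [← dist_eq_norm]; exact hz.1
  have hsq : 2 * ‖z - y‖ ^ 2 / τ ≤ 2 * r ^ 2 / τ := by gcongr
  have h1 := one_sided M τ hτ hreach y hy η hη hη1 z hz.2
  have h2 := one_sided M τ hτ hreach y hy (-η) (Submodule.neg_mem _ hη) (by rwa [norm_neg]) z hz.2
  rw [inner_neg_left] at h2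
  rw [abs_le]
  constructor <;> linarith

end
end

section
/- Let M be a C² compact d-dimensional submanifold of ℝ^D without boundary with reach τ > 0, let y ∈ M and r < τ/8, and let a, b be distinct points of B(y,r) ∩ M. Then there exists a unit vector u ∈ T_yM such that |⟨u, b − a⟩| ≥ ‖b − a‖·(1 − 8r/τ). -/
open MeasureTheory ProbabilityTheory Metric
open scoped ENNReal RealInnerProductSpace BigOperators Classical Matrix

noncomputable section

lemma le_of_sq_le_sq_aux {a b : ℝ} (h : a ^ 2 ≤ b ^ 2) (hb : 0 ≤ b) : a ≤ b :=
  (le_abs_self a).trans (abs_le_of_sq_le_sq h hb)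

/-- every point of the open `τ`-tube has at most one nearest point -/
def UnpTube {D : ℕ} (S : Set (Euc D)) (τ : ℝ) : Prop :=
  ∀ z, infDist z S < τ → ∀ p ∈ S, ∀ q ∈ S, dist z p = infDist z S → dist z q = infDist z S → p = q

lemma unpTube_of_reach {D : ℕ} (S : Set (Euc D)) (τ : ℝ) (h : reach S = τ) :
    UnpTube S τ := by
  intro z hz p hp q hq h1 h2
  rw [← h, reach] at hz
  have hne : {r : ℝ | 0 ≤ r ∧ ∀ y ∈ tube S r, ∃! x, x ∈ S ∧ dist y x = Metric.infDist y S}.Nonempty := by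
    refine ⟨0, le_refl _, ?_⟩
    intro y hy
    have : infDist y S < 0 := hy
    exact absurd this (not_lt.mpr infDist_nonneg)
  obtain ⟨r, hr, hzr⟩ := exists_lt_of_lt_csSup hne hz
  exact (hr.2 z hzr).unique ⟨hp, h1⟩ ⟨hq, h2⟩

lemma proj_cont {D : ℕ} {S : Set (Euc D)} {τ : ℝ} (hc : IsCompact S)
    (hU : UnpTube S τ) {w x : Euc D} (hx : x ∈ S) (hw : infDist w S < τ)
    (hwx : dist w x = infDist w S) {ε : ℝ} (hε : 0 < ε) :
    ∃ h0 > 0, ∀ w', dist w' w < h0 → ∀ x' ∈ S, dist w' x' = infDist w' S → dist x' x < ε := by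
  rcases (S \ ball x ε).eq_empty_or_nonempty with hK | hK
  · refine ⟨1, one_pos, fun w' _ x' hx' _ => ?_⟩
    by_contra hcon
    have : x' ∈ S \ ball x ε := ⟨hx', by simpa using hcon⟩
    rw [hK] at this
    exact this
  · have hKc : IsCompact (S \ ball x ε) := hc.diff isOpen_ball
    obtain ⟨q, hq, hmin⟩ := hKc.exists_isMinOn hK
      (f := fun p => dist w p) (by fun_prop)
    have hlt : infDist w S < dist w q := by
      rcases (infDist_le_dist_of_mem (x := w) hq.1).lt_or_eq with h | h
      · exact h
      · have := hU w hw q hq.1 x hx h.symm hwx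
        exact absurd (by rw [this]; exact mem_ball_self hε) hq.2
    refine ⟨(dist w q - infDist w S) / 2, by linarith, fun w' hw' x' hx' hd => ?_⟩
    by_contra hcon
    have hxK : x' ∈ S \ ball x ε := ⟨hx', by simpa using hcon⟩
    have h1 : dist w q ≤ dist w x' := hmin hxK
    have h2 : dist w x' ≤ dist w' w + dist w' x' := dist_triangle_left w x' w'
    have h3 : infDist w' S ≤ infDist w S + dist w' w := infDist_le_infDist_add_dist
    linarith

lemma slope_one {D : ℕ} {S : Set (Euc D)} {τ : ℝ} (hc : IsCompact S) (hne : S.Nonempty)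
    (hU : UnpTube S τ) {w : Euc D} (hw0 : 0 < infDist w S) (hw : infDist w S < τ)
    {θ : ℝ} (hθ0 : 0 ≤ θ) (hθ1 : θ < 1) {η : ℝ} (hη : 0 < η) :
    ∃ w', dist w' w < η ∧ infDist w S + θ * dist w' w < infDist w' S := by
  obtain ⟨x, hx, hwx⟩ := hc.exists_infDist_eq_dist hne w
  set d := infDist w S with hd
  have hε : 0 < (1 - θ) * d := mul_pos (by linarith) hw0
  obtain ⟨h0, hh0, hcont⟩ := proj_cont hc hU hx hw hwx.symm hε
  set h := min h0 η / 2 with hh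
  have hmin : 0 < min h0 η := lt_min hh0 hη
  have hpos : 0 < h := by positivity
  have hlt0 : h < h0 := by have := min_le_left h0 η; linarith
  have hltη : h < η := by have := min_le_right h0 η; linarith
  set k : Euc D := (1 / d) • (w - x) with hk
  have hnwx : ‖w - x‖ = d := by rw [← dist_eq_norm, ← hwx]
  have hkn : ‖k‖ = 1 := by
    rw [hk, norm_smul, hnwx, Real.norm_of_nonneg (by positivity)]
    field_simp
  have hdist : dist (w + h • k) w = h := by
    rw [dist_eq_norm, add_sub_cancel_left, norm_smul, hkn, Real.norm_of_nonneg hpos.le, mul_one]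
  refine ⟨w + h • k, by rw [hdist]; exact hltη, ?_⟩
  rw [hdist]
  obtain ⟨x', hx', hwx'⟩ := hc.exists_infDist_eq_dist hne (w + h • k)
  have hclose := hcont _ (by rw [hdist]; exact hlt0) x' hx' hwx'.symm
  rw [hwx', dist_eq_norm]
  have e1 : d ≤ ‖w - x'‖ := by
    rw [← dist_eq_norm]; exact infDist_le_dist_of_mem hx'
  have e2 : ‖w + h • k - x'‖ ^ 2 = ‖w - x'‖ ^ 2 + 2 * h * ⟪k, w - x'⟫ + h ^ 2 := by
    have : w + h • k - x' = (w - x') + h • k := by abel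
    rw [this, norm_add_sq_real, inner_smul_right, norm_smul, hkn, Real.norm_of_nonneg hpos.le,
      real_inner_comm]
    ring
  have e3 : ⟪k, w - x'⟫ = d - ⟪k, x' - x⟫ := by
    have : w - x' = (w - x) - (x' - x) := by abel
    rw [this, inner_sub_right]
    congr 1
    rw [hk, inner_smul_left, real_inner_self_eq_norm_sq, hnwx]
    simp
    field_simp
  have e4 : ⟪k, x' - x⟫ < (1 - θ) * d := by
    have := real_inner_le_norm k (x' - x)
    rw [hkn, one_mul, ← dist_eq_norm] at this
    linarith
  apply lt_of_pow_lt_pow_left₀ 2 (norm_nonneg _)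
  rw [e2, e3]
  have f1 : d ^ 2 ≤ ‖w - x'‖ ^ 2 := by gcongr
  have f2 : h * ⟪k, x' - x⟫ < h * ((1 - θ) * d) := by gcongr
  have f3 : θ ^ 2 * h ^ 2 ≤ 1 * h ^ 2 := by
    gcongr
    nlinarith
  nlinarith

lemma extend {D : ℕ} {S : Set (Euc D)} {τ : ℝ} (hc : IsCompact S) (hne : S.Nonempty)
    (hU : UnpTube S τ) {z x : Euc D} (hx : x ∈ S) {d η : ℝ} (hd : 0 < d)
    (hzx : dist z x = d) (hz : infDist z S = d) (hη : 0 < η) (hηd : η < d) (hτ : d + η < τ) :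
    infDist (z + (η / d) • (z - x)) S = d + η := by
  have hcb : IsCompact (closedBall z η) := isCompact_closedBall z η
  have hcbn : (closedBall z η).Nonempty := ⟨z, mem_closedBall_self hη.le⟩
  have hrange : ∀ w ∈ closedBall z η, 0 < infDist w S ∧ infDist w S < τ ∧ infDist w S ≤ d + η := by
    intro w hw
    rw [mem_closedBall] at hw
    have h1 : infDist w S ≤ infDist z S + dist w z := infDist_le_infDist_add_dist
    have h2 : infDist z S ≤ infDist w S + dist z w := infDist_le_infDist_add_dist
    rw [dist_comm] at h2
    refine ⟨by linarith, by linarith, by linarith⟩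
  have key : ∀ θ : ℝ, 0 ≤ θ → θ < 1 → ∃ w ∈ closedBall z η, d + θ * η ≤ infDist w S := by
    intro θ h0 h1
    obtain ⟨w, hw, hmax⟩ := hcb.exists_isMaxOn hcbn
      (f := fun w => infDist w S - θ * dist w z)
      (by apply Continuous.continuousOn
          exact (continuous_infDist_pt S).sub (by fun_prop))
    have hz' : infDist z S - θ * dist z z ≤ infDist w S - θ * dist w z :=
      hmax (mem_closedBall_self hη.le)
    rw [dist_self, hz] at hz'
    have hw' := mem_closedBall.mp hw
    rcases hw'.lt_or_eq with hlt | heq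
    · obtain ⟨hp, hq, _⟩ := hrange w hw
      obtain ⟨w', hw1, hw2⟩ := slope_one hc hne hU hp hq h0 h1 (sub_pos.mpr hlt)
      have htri : dist w' z ≤ dist w' w + dist w z := dist_triangle _ _ _
      have hm : infDist w' S - θ * dist w' z ≤ infDist w S - θ * dist w z :=
        hmax (mem_closedBall.mpr (by linarith))
      have : θ * dist w' z ≤ θ * (dist w' w + dist w z) := by gcongr
      nlinarith
    · refine ⟨w, hw, ?_⟩
      rw [heq] at hz'
      linarith
  obtain ⟨w, hw, hmax⟩ := hcb.exists_isMaxOn hcbn (f := fun w => infDist w S)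
    (continuous_infDist_pt S).continuousOn
  have hge : d + η ≤ infDist w S := by
    by_contra hcon
    push Not at hcon
    have hdw : d ≤ infDist w S := by
      have := hmax (mem_closedBall_self hη.le)
      simpa [hz] using this
    obtain ⟨w', hw', h⟩ := key (((infDist w S - d) / η + 1) / 2)
      (by have : 0 ≤ (infDist w S - d) / η := div_nonneg (by linarith) hη.le
          linarith)
      (by have : (infDist w S - d) / η < 1 := by rw [div_lt_one hη]; linarith
          linarith)
    have hm : infDist w' S ≤ infDist w S := hmax hw'
    have : ((infDist w S - d) / η + 1) / 2 * η = ((infDist w S - d) + η) / 2 := by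
      field_simp
    rw [this] at h
    linarith
  have hwx : d + η ≤ dist w x := hge.trans (infDist_le_dist_of_mem hx)
  have hwz : ‖w - z‖ ≤ η := by rw [← dist_eq_norm]; exact mem_closedBall.mp hw
  have hzx' : ‖z - x‖ = d := by rw [← dist_eq_norm, hzx]
  have hsum : ‖w - x‖ ^ 2 = ‖w - z‖ ^ 2 + 2 * ⟪w - z, z - x⟫ + ‖z - x‖ ^ 2 := by
    rw [← norm_add_sq_real]; congr 2; abel
  rw [dist_eq_norm] at hwx
  have hs1 : (d + η) ^ 2 ≤ ‖w - x‖ ^ 2 := by gcongr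
  have hs2 : ‖w - z‖ ^ 2 ≤ η ^ 2 := by gcongr
  have hin : η * d ≤ ⟪w - z, z - x⟫ := by rw [hzx'] at hsum; nlinarith
  have hzero : ‖(w - z) - (η / d) • (z - x)‖ ^ 2 ≤ 0 := by
    rw [norm_sub_sq_real, inner_smul_right, norm_smul, hzx', Real.norm_of_nonneg (by positivity)]
    have g1 : η / d * d = η := by field_simp
    have g2 : η / d * (η * d) ≤ η / d * ⟪w - z, z - x⟫ := by gcongr
    have g3 : η / d * (η * d) = η ^ 2 := by field_simp
    rw [g1]
    linarith
  have hEq : w = z + (η / d) • (z - x) := by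
    have : ‖(w - z) - (η / d) • (z - x)‖ = 0 := by
      have := norm_nonneg ((w - z) - (η / d) • (z - x))
      nlinarith
    rw [norm_eq_zero, sub_sub, sub_eq_zero] at this
    exact this
  rw [← hEq]
  exact le_antisymm (hrange w hw).2.2 hge

lemma ray {D : ℕ} {S : Set (Euc D)} {τ : ℝ} (hc : IsCompact S) (hne : S.Nonempty)
    (hU : UnpTube S τ) {x m : Euc D} (hx : x ∈ S) (hm : ‖m‖ = 1) {t0 t1 : ℝ} (h0 : 0 < t0)
    (h01 : t0 ≤ t1) (h1 : t1 < τ) (hstart : infDist (x + t0 • m) S = t0) :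
    infDist (x + t1 • m) S = t1 := by
  have hcl : IsClosed {t : ℝ | infDist (x + t • m) S = t} :=
    isClosed_eq ((continuous_infDist_pt S).comp (by fun_prop)) continuous_id
  have hK : IsCompact (Set.Icc t0 t1 ∩ {t : ℝ | infDist (x + t • m) S = t}) :=
    isCompact_Icc.inter_right hcl
  obtain ⟨T, ⟨⟨hT0, hT1⟩, hTS⟩, hTmax⟩ := hK.exists_isGreatest
    ⟨t0, ⟨le_refl _, h01⟩, hstart⟩
  rcases hT1.lt_or_eq with hlt | heq
  · exfalso
    have hTpos : 0 < T := by linarith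
    have hTS' : infDist (x + T • m) S = T := hTS
    set η := min (t1 - T) (T / 2) with hη
    have hηpos : 0 < η := lt_min (by linarith) (by linarith)
    have hη1 : η ≤ t1 - T := min_le_left _ _
    have hη2 : η ≤ T / 2 := min_le_right _ _
    have := extend hc hne hU (z := x + T • m) hx hTpos
      (by rw [dist_eq_norm, add_sub_cancel_left, norm_smul, hm, Real.norm_of_nonneg hTpos.le,
            mul_one]) hTS' hηpos (by linarith) (by linarith)
    have e : x + T • m + (η / T) • (x + T • m - x) = x + (T + η) • m := by
      rw [add_sub_cancel_left, smul_smul, div_mul_cancel₀ _ hTpos.ne', add_smul]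
      abel
    rw [e] at this
    have := hTmax ⟨⟨by linarith, by linarith⟩, this⟩
    linarith
  · rw [← heq]; exact hTS

lemma prox_ineq {D : ℕ} {S : Set (Euc D)} {τ : ℝ} (hc : IsCompact S) (hne : S.Nonempty)
    (hU : UnpTube S τ) {x m : Euc D} (hx : x ∈ S) (hm : ‖m‖ = 1) {t0 : ℝ} (h0 : 0 < t0)
    (h01 : t0 < τ) (hstart : infDist (x + t0 • m) S = t0) {p : Euc D} (hp : p ∈ S) :
    2 * τ * ⟪m, p - x⟫ ≤ ‖p - x‖ ^ 2 := by
  have key : ∀ t, t0 ≤ t → t < τ → 2 * t * ⟪m, p - x⟫ ≤ ‖p - x‖ ^ 2 := by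
    intro t ht1 ht2
    have h1 := ray hc hne hU hx hm h0 ht1 ht2 hstart
    have h2 : t ≤ ‖t • m - (p - x)‖ := by
      have h3 := infDist_le_dist_of_mem (x := x + t • m) hp
      rw [h1, dist_eq_norm] at h3
      have : x + t • m - p = t • m - (p - x) := by abel
      rwa [this] at h3
    have htp : 0 < t := by linarith
    have h3 : t ^ 2 ≤ ‖t • m - (p - x)‖ ^ 2 := by gcongr
    rw [norm_sub_sq_real, norm_smul, hm, inner_smul_left, Real.norm_of_nonneg htp.le] at h3
    simp at h3
    linarith
  have hτt : Filter.Tendsto (fun t : ℝ => 2 * t * ⟪m, p - x⟫) (nhdsWithin τ (Set.Iio τ))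
      (nhds (2 * τ * ⟪m, p - x⟫)) := by
    apply Filter.Tendsto.mono_left _ nhdsWithin_le_nhds
    apply Continuous.tendsto
    fun_prop
  refine le_of_tendsto hτt ?_
  filter_upwards [Ioo_mem_nhdsLT h01] with t ht
  exact key t ht.1.le ht.2

lemma proj_ineq {D : ℕ} {S : Set (Euc D)} {τ : ℝ} (hc : IsCompact S) (hne : S.Nonempty)
    (hU : UnpTube S τ) {z x : Euc D} (hx : x ∈ S) (hzx : dist z x = infDist z S)
    (hz : infDist z S < τ) {p : Euc D} (hp : p ∈ S) :
    2 * τ * ⟪z - x, p - x⟫ ≤ infDist z S * ‖p - x‖ ^ 2 := by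
  rcases (infDist_nonneg (x := z) (s := S)).eq_or_lt with h | h
  · rw [← h] at hzx
    rw [dist_eq_zero] at hzx
    rw [← h, hzx]; simp
  · set d := infDist z S with hd
    have hn : ‖z - x‖ = d := by rw [← dist_eq_norm, hzx]
    have hm : ‖(1 / d) • (z - x)‖ = 1 := by
      rw [norm_smul, hn, Real.norm_of_nonneg (by positivity)]; field_simp
    have e : d • (1 / d) • (z - x) = z - x := by
      rw [smul_smul, mul_one_div_cancel h.ne', one_smul]
    have := prox_ineq hc hne hU hx hm h hz (by rw [e, add_sub_cancel]) hp
    calc 2 * τ * ⟪z - x, p - x⟫ = d * (2 * τ * ⟪(1 / d) • (z - x), p - x⟫) := by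
          rw [inner_smul_left]; simp; field_simp
      _ ≤ _ := by gcongr

lemma proj_lip {D : ℕ} {S : Set (Euc D)} {τ : ℝ} (hτ : 0 < τ) (hc : IsCompact S)
    (hne : S.Nonempty)
    (hU : UnpTube S τ) {z1 z2 x1 x2 : Euc D} (hx1 : x1 ∈ S) (hx2 : x2 ∈ S)
    (h1 : dist z1 x1 = infDist z1 S) (h2 : dist z2 x2 = infDist z2 S)
    (hz1 : infDist z1 S ≤ τ / 8) (hz2 : infDist z2 S ≤ τ / 8) :
    ‖x1 - x2‖ ≤ 8 / 7 * ‖z1 - z2‖ := by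
  have i1 := proj_ineq hc hne hU hx1 h1 (by linarith) hx2
  have i2 := proj_ineq hc hne hU hx2 h2 (by linarith) hx1
  rw [norm_sub_rev x2 x1] at i1
  have j1 : infDist z1 S * ‖x1 - x2‖ ^ 2 ≤ τ / 8 * ‖x1 - x2‖ ^ 2 := by gcongr
  have j2 : infDist z2 S * ‖x1 - x2‖ ^ 2 ≤ τ / 8 * ‖x1 - x2‖ ^ 2 := by gcongr
  have e : ⟪z1 - x1, x2 - x1⟫ + ⟪z2 - x2, x1 - x2⟫ = ‖x1 - x2‖ ^ 2 - ⟪z1 - z2, x1 - x2⟫ := by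
    rw [← real_inner_self_eq_norm_sq, ← neg_sub x1 x2, inner_neg_right, ← sub_eq_neg_add,
      ← inner_sub_left, ← inner_sub_left]
    congr 1; abel
  have cs := real_inner_le_norm (z1 - z2) (x1 - x2)
  have k : 2 * τ * (‖x1 - x2‖ ^ 2 - ⟪z1 - z2, x1 - x2⟫) ≤ 2 * τ * (‖x1 - x2‖ ^ 2 / 8) := by
    rw [← e]; linarith
  have k2 := le_of_mul_le_mul_left k (by positivity)
  rcases (norm_nonneg (x1 - x2)).eq_or_lt with h | h
  · rw [← h]; positivity
  · have : ‖x1 - x2‖ * ‖x1 - x2‖ ≤ (8 / 7 * ‖z1 - z2‖) * ‖x1 - x2‖ := by nlinarith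
    exact le_of_mul_le_mul_right this h

lemma dim_symm {D : ℕ} (V W : Submodule ℝ (Euc D))
    (hdim : Module.finrank ℝ V = Module.finrank ℝ W) {σ : ℝ} (h0 : 0 ≤ σ) (h1 : σ < 1)
    (h : ∀ v ∈ V, ∀ m ∈ Wᗮ, ⟪v, m⟫ ≤ σ * (‖v‖ * ‖m‖)) :
    ∀ w ∈ W, ∀ n ∈ Vᗮ, ⟪w, n⟫ ≤ σ * (‖w‖ * ‖n‖) := by
  set L : V →ₗ[ℝ] W := (W.orthogonalProjectionOnto : Euc D →ₗ[ℝ] W) ∘ₗ V.subtype with hL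
  have hinj : Function.Injective L := by
    rw [← LinearMap.ker_eq_bot, LinearMap.ker_eq_bot']
    intro v hv
    have hv' : W.orthogonalProjectionOnto (v : Euc D) = 0 := hv
    have hvW : (v : Euc D) ∈ Wᗮ := Submodule.orthogonalProjectionOnto_eq_zero_iff.mp hv'
    have := h v v.2 v hvW
    rw [real_inner_self_eq_norm_sq] at this
    have hn : ‖(v : Euc D)‖ = 0 := by
      by_contra hne
      have : 0 < ‖(v : Euc D)‖ := lt_of_le_of_ne (norm_nonneg _) (Ne.symm hne)
      nlinarith [mul_pos this this]
    exact Subtype.ext (norm_eq_zero.mp hn)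
  have hsurj : Function.Surjective L :=
    (LinearMap.injective_iff_surjective_of_finrank_eq_finrank hdim).mp hinj
  intro w hw n hn
  obtain ⟨v, hv⟩ := hsurj ⟨w, hw⟩
  have hv' : (W.orthogonalProjectionOnto (v : Euc D) : Euc D) = w := congrArg Subtype.val hv
  set m : Euc D := v - w with hm
  have hmW : m ∈ Wᗮ := by
    rw [hm, ← hv']; exact Submodule.sub_starProjection_mem_orthogonal (K := W) _
  have hvn : ⟪(v : Euc D), n⟫ = 0 := (Submodule.mem_orthogonal _ _).mp hn v v.2
  have hwm : ⟪w, m⟫ = 0 := (Submodule.mem_orthogonal _ _).mp hmW w hw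
  have hvwm : (v : Euc D) = w + m := by rw [hm]; abel
  have hvsq : ‖(v : Euc D)‖ ^ 2 = ‖w‖ ^ 2 + ‖m‖ ^ 2 := by
    rw [hvwm, norm_add_sq_real, hwm]; ring
  have hmle : ‖m‖ ≤ σ * ‖(v : Euc D)‖ := by
    have := h v v.2 m hmW
    have e : ⟪(v : Euc D), m⟫ = ‖m‖ ^ 2 := by
      rw [hvwm, inner_add_left, hwm, real_inner_self_eq_norm_sq, zero_add]
    rw [e] at this
    rcases (norm_nonneg m).eq_or_lt with h | h
    · rw [← h]; positivity
    · have : ‖m‖ * ‖m‖ ≤ (σ * ‖(v : Euc D)‖) * ‖m‖ := by nlinarith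
      exact le_of_mul_le_mul_right this h
  rcases (norm_nonneg (v : Euc D)).eq_or_lt with hv0 | hvpos
  · have : ‖w‖ = 0 := by
      rw [← hv0] at hvsq
      nlinarith [sq_nonneg ‖m‖, norm_nonneg w]
    rw [norm_eq_zero.mp this]; simp
  set c := ‖w‖ ^ 2 / ‖(v : Euc D)‖ ^ 2 with hc
  have hwv : ⟪w, (v : Euc D)⟫ = ‖w‖ ^ 2 := by
    rw [hvwm, inner_add_right, hwm, real_inner_self_eq_norm_sq, add_zero]
  have hres : ‖w - c • (v : Euc D)‖ ≤ σ * ‖w‖ := by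
    apply le_of_sq_le_sq_aux _ (by positivity)
    rw [norm_sub_sq_real, inner_smul_right, hwv, norm_smul, mul_pow, Real.norm_eq_abs, sq_abs]
    have e : ‖w‖ ^ 2 - 2 * (c * ‖w‖ ^ 2) + c ^ 2 * ‖(v : Euc D)‖ ^ 2
        = ‖w‖ ^ 2 * (‖m‖ ^ 2 / ‖(v : Euc D)‖ ^ 2) := by
      have : ‖m‖ ^ 2 = ‖(v : Euc D)‖ ^ 2 - ‖w‖ ^ 2 := by linarith
      rw [hc, this]; field_simp; ring
    rw [e]
    have : ‖m‖ ^ 2 / ‖(v : Euc D)‖ ^ 2 ≤ σ ^ 2 := by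
      rw [div_le_iff₀ (by positivity), ← mul_pow]; gcongr
    calc ‖w‖ ^ 2 * (‖m‖ ^ 2 / ‖(v : Euc D)‖ ^ 2) ≤ ‖w‖ ^ 2 * σ ^ 2 := by gcongr
      _ = _ := by ring
  calc ⟪w, n⟫ = ⟪w - c • (v : Euc D), n⟫ := by
        rw [inner_sub_left, inner_smul_left, hvn]; simp
    _ ≤ ‖w - c • (v : Euc D)‖ * ‖n‖ := real_inner_le_norm _ _
    _ ≤ (σ * ‖w‖) * ‖n‖ := by gcongr
    _ = _ := by ring

lemma proj_norm_le {D : ℕ} (V W : Submodule ℝ (Euc D)) {σ : ℝ}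
    (h : ∀ w ∈ W, ∀ n ∈ Vᗮ, ⟪w, n⟫ ≤ σ * (‖w‖ * ‖n‖)) (hσ : 0 ≤ σ) (n : Euc D) :
    ‖W.starProjection n‖ ≤ ‖V.starProjection n‖ + σ * ‖n‖ := by
  set w := W.starProjection n with hw
  have hwW : w ∈ W := Submodule.starProjection_apply_mem W n
  have e1 : ⟪w, n⟫ = ‖w‖ ^ 2 := by
    have : ⟪w, n - w⟫ = 0 := (Submodule.mem_orthogonal _ _).mp
      (Submodule.sub_starProjection_mem_orthogonal (K := W) n) w hwW
    rw [inner_sub_right, real_inner_self_eq_norm_sq] at this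
    linarith
  have hV : n - V.starProjection n ∈ Vᗮ := Submodule.sub_starProjection_mem_orthogonal (K := V) n
  have e2 := h w hwW _ hV
  have e3 : ‖n - V.starProjection n‖ ≤ ‖n‖ := by
    have : ⟪V.starProjection n, n - V.starProjection n⟫ = 0 := (Submodule.mem_orthogonal _ _).mp
      hV _ (Submodule.starProjection_apply_mem V n)
    apply le_of_sq_le_sq_aux _ (norm_nonneg _)
    have hh := norm_add_sq_real (V.starProjection n) (n - V.starProjection n)
    rw [this, add_sub_cancel] at hh
    nlinarith [sq_nonneg ‖V.starProjection n‖]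
  have e4 := real_inner_le_norm w (V.starProjection n)
  rw [inner_sub_right, e1] at e2
  have e5 : σ * (‖w‖ * ‖n - V.starProjection n‖) ≤ σ * (‖w‖ * ‖n‖) := by gcongr
  rcases (norm_nonneg w).eq_or_lt with h | h
  · rw [← h]; positivity
  · have : ‖w‖ * ‖w‖ ≤ ‖w‖ * (‖V.starProjection n‖ + σ * ‖n‖) := by nlinarith
    exact le_of_mul_le_mul_left this h

lemma quad_bound {E F : Type*} [NormedAddCommGroup E] [NormedSpace ℝ E]
    [NormedAddCommGroup F] [NormedSpace ℝ F] (f : E → F) (hf : ContDiff ℝ 2 f)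
    (h0 : f 0 = 0) (h1 : fderiv ℝ f 0 = 0) :
    ∃ K > 0, ∃ ρ > 0, ∀ v, ‖v‖ < ρ → ‖f v‖ ≤ K * ‖v‖ ^ 2 := by
  have hd : ContDiff ℝ 1 (fderiv ℝ f) := hf.fderiv_right (by norm_num)
  obtain ⟨K, t, ht, hK⟩ := hd.contDiffAt.exists_lipschitzOnWith (x := (0 : E))
  obtain ⟨ρ, hρ, hball⟩ := Metric.mem_nhds_iff.mp ht
  refine ⟨K + 1, by positivity, ρ, hρ, fun v hv => ?_⟩
  have hb : ∀ x ∈ closedBall (0 : E) ‖v‖, ‖fderiv ℝ f x‖ ≤ (K + 1) * ‖v‖ := by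
    intro x hx
    rw [mem_closedBall, dist_zero_right] at hx
    have := hK.norm_sub_le (hball (show x ∈ ball (0:E) ρ by simpa using lt_of_le_of_lt hx hv))
      (hball (mem_ball_self hρ))
    rw [h1, sub_zero, sub_zero] at this
    calc _ ≤ K * ‖x‖ := this
      _ ≤ (K + 1) * ‖v‖ := by gcongr; linarith
  have := (convex_closedBall (0 : E) ‖v‖).norm_image_sub_le_of_norm_fderiv_le
    (f := f) (fun x _ => (hf.differentiable (by norm_num)).differentiableAt) hb
    (mem_closedBall_self (norm_nonneg _)) (show v ∈ closedBall (0 : E) ‖v‖ by simp)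
  rw [h0, sub_zero, sub_zero] at this
  linarith [this, show (K + 1 : ℝ) * ‖v‖ * ‖v‖ = (K + 1) * ‖v‖ ^ 2 by ring]

/-- Federer inequality for normal vectors. -/
lemma normal_ineq {D d : ℕ} (M : C2CompactSubmanifold D d) {τ : ℝ} (hτ : 0 < τ)
    (hU : UnpTube M.carrier τ) {x : Euc D} (hx : x ∈ M.carrier) {n : Euc D}
    (hn : n ∈ (M.tangentAt x)ᗮ) {p : Euc D} (hp : p ∈ M.carrier) :
    2 * τ * ⟪n, p - x⟫ ≤ ‖n‖ * ‖p - x‖ ^ 2 := by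
  rcases (norm_nonneg n).eq_or_lt with h | hnpos
  · rw [← h, norm_eq_zero.mp h.symm]; simp
  obtain ⟨ε, hε, f, hf, hf0, hf1, hgraph⟩ := M.locally_graph x hx
  obtain ⟨K, hK, ρ, hρ, hquad⟩ := quad_bound f hf hf0 hf1
  set m : Euc D := (1 / ‖n‖) • n with hm
  have hmn : ‖m‖ = 1 := by
    rw [hm, norm_smul, Real.norm_of_nonneg (by positivity)]; field_simp
  have hmN : m ∈ (M.tangentAt x)ᗮ := Submodule.smul_mem _ _ hn
  set t := min (min (τ / 2) (min ε ρ / 2)) (1 / (2 * K)) with ht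
  have htpos : 0 < t := by
    refine lt_min (lt_min (by linarith) ?_) (by positivity)
    have := lt_min hε hρ
    linarith
  have ht1 : t ≤ τ / 2 := (min_le_left _ _).trans (min_le_left _ _)
  have ht2' : t ≤ min ε ρ / 2 := (min_le_left _ _).trans (min_le_right _ _)
  have ht3 : t ≤ 1 / (2 * K) := min_le_right _ _
  have hstart : infDist (x + t • m) M.carrier = t := by
    apply le_antisymm
    · have := infDist_le_dist_of_mem (x := x + t • m) hx
      rwa [dist_eq_norm, add_sub_cancel_left, norm_smul, hmn, Real.norm_of_nonneg htpos.le,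
        mul_one] at this
    · rw [le_infDist M.nonempty]
      intro q hq
      by_cases hqε : q ∈ ball x (min ε ρ)
      · have hqb : q ∈ ball x ε := ball_subset_ball (min_le_left _ _) hqε
        have hqm : q ∈ M.carrier ∩ ball x ε := ⟨hq, hqb⟩
        rw [hgraph] at hqm
        obtain ⟨⟨v, hv⟩, _⟩ := hqm
        simp only at hv
        have horth : ⟪(v : Euc D), (f v : Euc D)⟫ = 0 :=
          (Submodule.mem_orthogonal _ _).mp (f v).2 v v.2
        have horthm : ⟪(v : Euc D), m⟫ = 0 := (Submodule.mem_orthogonal _ _).mp hmN v v.2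
        have hvρ : ‖v‖ < ρ := by
          have h1 : ‖q - x‖ < ρ := by
            rw [← dist_eq_norm]; exact (mem_ball.mp hqε).trans_le (min_le_right _ _)
          have h2 : ‖q - x‖ ^ 2 = ‖(v : Euc D)‖ ^ 2 + ‖(f v : Euc D)‖ ^ 2 := by
            have : q - x = (v : Euc D) + f v := by rw [← hv]; abel
            rw [this, norm_add_sq_real, horth]; ring
          refine lt_of_le_of_lt ?_ h1
          apply le_of_sq_le_sq_aux _ (norm_nonneg _)
          rw [h2]
          have : ‖v‖ = ‖(v : Euc D)‖ := rfl
          rw [this]; nlinarith [sq_nonneg ‖(f v : Euc D)‖]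
        have hq2 := hquad v hvρ
        have hfv : ‖(f v : Euc D)‖ ≤ K * ‖(v : Euc D)‖ ^ 2 := hq2
        rw [dist_eq_norm]
        apply le_of_sq_le_sq_aux _ (norm_nonneg _)
        have e : x + t • m - q = t • m - ((v : Euc D) + f v) := by rw [← hv]; abel
        rw [e, norm_sub_sq_real, inner_add_right, real_inner_smul_left m _ t, real_inner_smul_left m _ t,
          real_inner_comm, horthm, norm_add_sq_real, horth, norm_smul, hmn,
          Real.norm_of_nonneg htpos.le]
        have cs := real_inner_le_norm m (f v : Euc D)
        rw [hmn, one_mul] at cs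
        have c1 : t * ⟪m, (f v : Euc D)⟫ ≤ t * (K * ‖(v : Euc D)‖ ^ 2) := by
          gcongr; linarith
        have c2 : t * (K * ‖(v : Euc D)‖ ^ 2) ≤ 1 / (2 * K) * (K * ‖(v : Euc D)‖ ^ 2) := by
          gcongr
        have c3 : 1 / (2 * K) * (K * ‖(v : Euc D)‖ ^ 2) = ‖(v : Euc D)‖ ^ 2 / 2 := by
          field_simp
        nlinarith [sq_nonneg ‖(f v : Euc D)‖]
      · rw [mem_ball, not_lt] at hqε
        have h1 : dist q x ≤ dist (x + t • m) q + dist (x + t • m) x := by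
          exact dist_triangle_left q x _
        have h2 : dist (x + t • m) x = t := by
          rw [dist_eq_norm, add_sub_cancel_left, norm_smul, hmn, Real.norm_of_nonneg htpos.le,
            mul_one]
        linarith
  have := prox_ineq M.isCompact M.nonempty hU hx hmn htpos (by linarith) hstart hp
  calc 2 * τ * ⟪n, p - x⟫ = ‖n‖ * (2 * τ * ⟪m, p - x⟫) := by
        rw [hm, inner_smul_left]; simp; field_simp
    _ ≤ _ := by gcongr

lemma local_angle {D d : ℕ} (M : C2CompactSubmanifold D d) {τ : ℝ} (hτ : 0 < τ)
    (hU : UnpTube M.carrier τ) {x : Euc D} (hx : x ∈ M.carrier) :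
    ∃ δ0 > 0, ∀ x' ∈ M.carrier, ‖x' - x‖ < δ0 → ∀ v ∈ M.tangentAt x,
      ∀ m ∈ (M.tangentAt x')ᗮ, ⟪v, m⟫ ≤ (6 / τ * ‖x' - x‖) * (‖v‖ * ‖m‖) := by
  obtain ⟨ε, hε, f, hf, hf0, hf1, hgraph⟩ := M.locally_graph x hx
  obtain ⟨K, hK, ρ, hρ, hquad⟩ := quad_bound f hf hf0 hf1
  refine ⟨min (min (ε / 2) ρ) (1 / K), lt_min (lt_min (by linarith) hρ) (by positivity), ?_⟩
  intro x' hx' hδ v hv m hm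
  have hδ1 : ‖x' - x‖ < ε / 2 := hδ.trans_le ((min_le_left _ _).trans (min_le_left _ _))
  have hδ2 : ‖x' - x‖ < ρ := hδ.trans_le ((min_le_left _ _).trans (min_le_right _ _))
  have hδ3 : ‖x' - x‖ < 1 / K := hδ.trans_le (min_le_right _ _)
  rcases (norm_nonneg (x' - x)).eq_or_lt with h | hδpos
  · have : x' = x := by rw [← sub_eq_zero]; exact norm_eq_zero.mp h.symm
    subst this
    rw [(Submodule.mem_orthogonal _ _).mp hm v hv]; simp
  set δ := ‖x' - x‖ with hδdef
  -- scaled version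
  have key : ∀ v ∈ M.tangentAt x, ‖v‖ = δ → ⟪v, m⟫ ≤ 6 / τ * δ ^ 2 * ‖m‖ := by
    intro v hv hvn
    set v' : M.tangentAt x := ⟨v, hv⟩
    set F : Euc D := (f v' : Euc D) with hF
    have hFN : F ∈ (M.tangentAt x)ᗮ := (f v').2
    have hvF : ⟪v, F⟫ = 0 := (Submodule.mem_orthogonal _ _).mp hFN v hv
    have hv'n : ‖v'‖ = δ := hvn
    have hFq : ‖F‖ ≤ K * ‖v'‖ ^ 2 := hquad v' (by rw [hv'n]; exact hδ2)
    rw [hv'n] at hFq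
    have hFδ : ‖F‖ ≤ δ := by
      rw [lt_div_iff₀ hK] at hδ3
      nlinarith
    set p : Euc D := x + v + F with hp
    have hpx : p - x = v + F := by rw [hp]; abel
    have hpxn : ‖p - x‖ ≤ 2 * δ := by
      rw [hpx]; have := norm_add_le v F; linarith
    have hpM : p ∈ M.carrier := by
      have : p ∈ (Set.range fun v : M.tangentAt x => x + (v : Euc D) + (f v : Euc D)) ∩ ball x ε :=
        ⟨⟨v', rfl⟩, by rw [mem_ball, dist_eq_norm]; linarith⟩
      rw [← hgraph] at this
      exact this.1
    have hpx2 : ‖p - x‖ ^ 2 = δ ^ 2 + ‖F‖ ^ 2 := by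
      rw [hpx, norm_add_sq_real, hvF, hvn]; ring
    have hF2 : ‖F‖ ^ 2 ≤ δ ^ 2 := by gcongr
    have hFb : τ * ‖F‖ ≤ δ ^ 2 := by
      have := normal_ineq M hτ hU hx hFN hpM
      rw [hpx2, hpx, inner_add_right, real_inner_self_eq_norm_sq, real_inner_comm, hvF,
        zero_add] at this
      rcases (norm_nonneg F).eq_or_lt with h | h
      · rw [← h, mul_zero]; positivity
      · have : ‖F‖ * (τ * ‖F‖) ≤ ‖F‖ * δ ^ 2 := by nlinarith
        exact le_of_mul_le_mul_left this h
    have hpx' : ‖p - x'‖ ≤ 3 * δ := by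
      have : p - x' = (p - x) - (x' - x) := by abel
      rw [this]; have := norm_sub_le (p - x) (x' - x); linarith
    have n1 := normal_ineq M hτ hU hx' hm hpM
    have n2 := normal_ineq M hτ hU hx' (Submodule.neg_mem _ hm) hx
    rw [norm_neg, inner_neg_left, ← neg_sub x' x, inner_neg_right, neg_neg, norm_neg] at n2
    have hp2 : ‖p - x'‖ ^ 2 ≤ (3 * δ) ^ 2 := by gcongr
    have n1' : ‖m‖ * ‖p - x'‖ ^ 2 ≤ ‖m‖ * (3 * δ) ^ 2 := by gcongr
    have n3 : -⟪m, F⟫ ≤ ‖m‖ * ‖F‖ := by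
      have := abs_real_inner_le_norm m F
      exact (neg_le_abs _).trans this
    have n3' : τ * (-⟪m, F⟫) ≤ ‖m‖ * δ ^ 2 := by
      calc τ * (-⟪m, F⟫) ≤ τ * (‖m‖ * ‖F‖) := by gcongr
        _ = ‖m‖ * (τ * ‖F‖) := by ring
        _ ≤ _ := by gcongr
    have e : ⟪v, m⟫ = ⟪m, p - x'⟫ + ⟪m, x' - x⟫ - ⟪m, F⟫ := by
      rw [real_inner_comm, ← inner_add_right, ← inner_sub_right]
      congr 1; rw [hp]; abel
    have : τ * ⟪v, m⟫ ≤ 6 * δ ^ 2 * ‖m‖ := by rw [e]; nlinarith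
    have e2 : 6 / τ * δ ^ 2 * ‖m‖ = 6 * δ ^ 2 * ‖m‖ / τ := by ring
    rw [e2, le_div_iff₀ hτ]; linarith
  rcases (norm_nonneg v).eq_or_lt with h | hvpos
  · rw [← h, norm_eq_zero.mp h.symm]; simp
  have := key ((δ / ‖v‖) • v) (Submodule.smul_mem _ _ hv) (by
    rw [norm_smul, Real.norm_of_nonneg (by positivity)]; field_simp)
  rw [inner_smul_left] at this
  simp only [conj_trivial] at this
  have e : ⟪v, m⟫ = (‖v‖ / δ) * (δ / ‖v‖ * ⟪v, m⟫) := by field_simp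
  rw [e]
  calc (‖v‖ / δ) * (δ / ‖v‖ * ⟪v, m⟫) ≤ (‖v‖ / δ) * (6 / τ * δ ^ 2 * ‖m‖) := by gcongr
    _ = _ := by field_simp

lemma local_proj {D d : ℕ} (M : C2CompactSubmanifold D d) {τ : ℝ} (hτ : 0 < τ)
    (hU : UnpTube M.carrier τ) {x : Euc D} (hx : x ∈ M.carrier) (n : Euc D) :
    ∃ δ0 > 0, ∀ x' ∈ M.carrier, ‖x' - x‖ < δ0 →
      |‖(M.tangentAt x').starProjection n‖ - ‖(M.tangentAt x).starProjection n‖|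
        ≤ (6 / τ * ‖x' - x‖) * ‖n‖ := by
  obtain ⟨δ0, hδ0, H⟩ := local_angle M hτ hU hx
  refine ⟨min δ0 (τ / 6), lt_min hδ0 (by positivity), fun x' hx' hlt => ?_⟩
  have h1 := hlt.trans_le (min_le_left _ _)
  have h2 := hlt.trans_le (min_le_right _ _)
  have hσ : 0 ≤ 6 / τ * ‖x' - x‖ := by positivity
  have hσ1 : 6 / τ * ‖x' - x‖ < 1 := by
    rw [div_mul_eq_mul_div, div_lt_one hτ]; linarith
  have hA := H x' hx' h1
  have hB := dim_symm _ _
    ((M.finrank_tangent x hx).trans (M.finrank_tangent x' hx').symm) hσ hσ1 hA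
  have p1 := proj_norm_le _ _ hB hσ n
  have p2 := proj_norm_le _ _ hA hσ n
  rw [abs_le]; constructor <;> linarith

lemma global_proj {D d : ℕ} (M : C2CompactSubmanifold D d) {τ : ℝ} (hτ : 0 < τ)
    (hU : UnpTube M.carrier τ) {y a : Euc D} (hy : y ∈ M.carrier) (ha : a ∈ M.carrier)
    (hay : ‖a - y‖ ≤ τ / 8) {n : Euc D} (hn : n ∈ (M.tangentAt y)ᗮ) :
    ‖(M.tangentAt a).starProjection n‖ ≤ 48 / 7 / τ * ‖a - y‖ * ‖n‖ := by
  choose π hπ hπd using fun z => M.isCompact.exists_infDist_eq_dist M.nonempty z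
  have hfix : ∀ z ∈ M.carrier, π z = z := by
    intro z hz
    have := hπd z
    rw [infDist_zero_of_mem hz] at this
    exact (dist_eq_zero.mp this.symm).symm
  set z : ℝ → Euc D := fun s => y + s • (a - y) with hz
  set g : ℝ → Euc D := fun s => π (z s) with hg
  have hdist : ∀ s ∈ Set.Icc (0:ℝ) 1, infDist (z s) M.carrier ≤ τ / 8 := by
    intro s hs
    have h1 := infDist_le_dist_of_mem (x := z s) hy
    rw [dist_eq_norm, hz] at h1
    simp only [add_sub_cancel_left] at h1
    rw [norm_smul, Real.norm_of_nonneg hs.1] at h1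
    have : s * ‖a - y‖ ≤ 1 * ‖a - y‖ := by gcongr; exact hs.2
    have h2 : infDist (z s) M.carrier ≤ s * ‖a - y‖ := h1
    linarith
  have hlip : ∀ s ∈ Set.Icc (0:ℝ) 1, ∀ s' ∈ Set.Icc (0:ℝ) 1,
      ‖g s' - g s‖ ≤ 8 / 7 * ‖a - y‖ * |s' - s| := by
    intro s hs s' hs'
    have := proj_lip hτ M.isCompact M.nonempty hU (hπ (z s')) (hπ (z s)) (hπd _).symm (hπd _).symm
      (hdist s' hs') (hdist s hs)
    have e : z s' - z s = (s' - s) • (a - y) := by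
      simp only [hz]; rw [sub_smul]; abel
    rw [e, norm_smul, Real.norm_eq_abs] at this
    calc _ ≤ _ := this
      _ = _ := by ring
  set ψ : ℝ → ℝ := fun s => ‖(M.tangentAt (g s)).starProjection n‖ with hψ
  set C : ℝ := 48 / 7 / τ * ‖a - y‖ * ‖n‖ with hC
  have hCnn : 0 ≤ C := by positivity
  have hloc : ∀ s ∈ Set.Icc (0:ℝ) 1, ∀ᶠ s' in nhdsWithin s (Set.Icc 0 1),
      |ψ s' - ψ s| ≤ C * |s' - s| := by
    intro s hs
    obtain ⟨δ0, hδ0, H⟩ := local_proj M hτ hU (hπ (z s)) n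
    have hnear : ∀ᶠ s' in nhdsWithin s (Set.Icc (0:ℝ) 1), 8 / 7 * ‖a - y‖ * |s' - s| < δ0 := by
      apply Filter.Eventually.filter_mono nhdsWithin_le_nhds
      have : Continuous fun s' : ℝ => 8 / 7 * ‖a - y‖ * |s' - s| := by fun_prop
      exact this.continuousAt.eventually_lt continuousAt_const (by simpa using hδ0)
    filter_upwards [hnear, self_mem_nhdsWithin] with s' h1 h2
    have h3 := hlip s hs s' h2
    have h4 := H (g s') (hπ _) (h3.trans_lt h1)
    calc |ψ s' - ψ s| ≤ 6 / τ * ‖g s' - g s‖ * ‖n‖ := h4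
      _ ≤ 6 / τ * (8 / 7 * ‖a - y‖ * |s' - s|) * ‖n‖ := by gcongr
      _ = _ := by rw [hC]; ring
  have hcont : ContinuousOn ψ (Set.Icc 0 1) := by
    intro s hs
    rw [ContinuousWithinAt, tendsto_iff_dist_tendsto_zero]
    refine squeeze_zero' (Filter.Eventually.of_forall fun _ => dist_nonneg)
      (g := fun s' => C * |s' - s|) ?_ ?_
    · filter_upwards [hloc s hs] with s' h
      rwa [Real.dist_eq]
    · have : Continuous fun s' : ℝ => C * |s' - s| := by fun_prop
      have := this.tendsto s
      simp only [sub_self, abs_zero, mul_zero] at this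
      exact this.mono_left nhdsWithin_le_nhds
  have hψ0 : ψ 0 = 0 := by
    have : g 0 = y := by simp only [hg, hz, zero_smul, add_zero]; exact hfix y hy
    simp only [hψ, this]
    rw [norm_eq_zero]
    exact (Submodule.starProjection_apply_eq_zero_iff _).mpr hn
  have hψ1 : ψ 1 = ‖(M.tangentAt a).starProjection n‖ := by
    have : g 1 = a := by
      simp only [hg, hz, one_smul, add_sub_cancel]; exact hfix a ha
    simp only [hψ, this]
  have main := image_le_of_liminf_slope_right_le_deriv_boundary (f := ψ) (a := 0) (b := 1)
    (B := fun s => C * s) (B' := fun _ => C) hcont (by simp [hψ0]) (by fun_prop)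
    (fun x _ => by simpa using ((hasDerivAt_id x).const_mul C).hasDerivWithinAt)
    (by
      intro s hs r hr
      apply Filter.Eventually.frequently
      have hs' : s ∈ Set.Icc (0:ℝ) 1 := ⟨hs.1, hs.2.le⟩
      have hle : nhdsWithin s (Set.Ioi s) ≤ nhdsWithin s (Set.Icc 0 1) := by
        rw [← nhdsWithin_Ioo_eq_nhdsGT hs.2]
        apply nhdsWithin_mono
        intro u hu
        exact ⟨hs.1.trans hu.1.le, hu.2.le⟩
      filter_upwards [(hloc s hs').filter_mono hle, self_mem_nhdsWithin] with u hu hus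
      have hpos : 0 < u - s := sub_pos.mpr hus
      rw [slope_def_field, div_lt_iff₀ hpos]
      rw [abs_of_pos hpos] at hu
      have := le_abs_self (ψ u - ψ s)
      nlinarith)
  have := main (show (1:ℝ) ∈ Set.Icc (0:ℝ) 1 by simp)
  rw [hψ1] at this
  simpa using this

/-- If `M` is a `C²` compact `d`-dimensional submanifold of `ℝ^D` without
boundary with reach `τ > 0`, `y ∈ M`, `r < τ/8`, and `a ≠ b` are points of `B(y,r) ∩ M`,
then there is a unit tangent vector `u ∈ T_yM` with `|⟨u, b − a⟩| ≥ ‖b − a‖ (1 − 8r/τ)`. -/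
theorem exists_unit_tangent_lower_bound {D d : ℕ} (M : C2CompactSubmanifold D d) (τ : ℝ)
    (hτ : 0 < τ) (hreach : reach M.carrier = τ)
    (y : Euc D) (hy : y ∈ M.carrier) (r : ℝ) (hr : r < τ / 8)
    (a b : Euc D) (ha : a ∈ ball y r ∩ M.carrier) (hb : b ∈ ball y r ∩ M.carrier)
    (hab : a ≠ b) :
    ∃ u : Euc D, u ∈ M.tangentAt y ∧ ‖u‖ = 1 ∧
      ‖b - a‖ * (1 - 8 * r / τ) ≤ |(⟪u, b - a⟫)| := by
  have hU := unpTube_of_reach M.carrier τ hreach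
  obtain ⟨haB, haM⟩ := ha
  obtain ⟨hbB, hbM⟩ := hb
  rw [mem_ball, dist_eq_norm] at haB hbB
  have hrpos : 0 < r := lt_of_le_of_lt (norm_nonneg _) haB
  set e := b - a with he
  have hepos : 0 < ‖e‖ := norm_pos_iff.mpr (sub_ne_zero.mpr (Ne.symm hab))
  have he2 : ‖e‖ ≤ 2 * r := by
    have : e = (b - y) - (a - y) := by rw [he]; abel
    rw [this]; have := norm_sub_le (b - y) (a - y); linarith
  set T := M.tangentAt y with hT
  set P := T.starProjection e with hP
  set w := e - P with hw
  have hPT : P ∈ T := Submodule.starProjection_apply_mem T e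
  have hwN : w ∈ Tᗮ := Submodule.sub_starProjection_mem_orthogonal (K := T) e
  have hPw : ⟪P, w⟫ = 0 := (Submodule.mem_orthogonal _ _).mp hwN P hPT
  have hePw : e = P + w := by rw [hw]; abel
  have hpyth : ‖e‖ ^ 2 = ‖P‖ ^ 2 + ‖w‖ ^ 2 := by
    rw [hePw, norm_add_sq_real, hPw]; ring
  have hwe : ⟪w, e⟫ = ‖w‖ ^ 2 := by
    rw [hePw, inner_add_right, real_inner_comm, hPw, real_inner_self_eq_norm_sq, zero_add]
  have hPe : ⟪P, e⟫ = ‖P‖ ^ 2 := by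
    rw [hePw, inner_add_right, hPw, real_inner_self_eq_norm_sq, add_zero]
  have hg := global_proj M hτ hU hy haM (by linarith) hwN
  set A := (M.tangentAt a).starProjection w with hA
  have hAN : w - A ∈ (M.tangentAt a)ᗮ :=
    Submodule.sub_starProjection_mem_orthogonal (K := M.tangentAt a) w
  have hAA : ⟪A, w - A⟫ = 0 := (Submodule.mem_orthogonal _ _).mp hAN A
    (Submodule.starProjection_apply_mem _ w)
  have hAw : ‖w - A‖ ≤ ‖w‖ := by
    apply le_of_sq_le_sq_aux _ (norm_nonneg _)
    have hh := norm_add_sq_real A (w - A)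
    rw [hAA, add_sub_cancel] at hh
    nlinarith [sq_nonneg ‖A‖]
  have hnorm := normal_ineq M hτ hU haM hAN hbM
  rw [← he] at hnorm
  have hsplit : ⟪w, e⟫ = ⟪A, e⟫ + ⟪w - A, e⟫ := by
    rw [← inner_add_left, add_sub_cancel]
  have hAe : ⟪A, e⟫ ≤ ‖A‖ * ‖e‖ := real_inner_le_norm _ _
  set ρ := r / τ with hρ
  have hρτ : ρ * τ = r := by rw [hρ]; field_simp
  have hρpos : 0 < ρ := by positivity
  have hρ8 : 8 * ρ < 1 := by
    have : ρ < 1 / 8 := by rw [hρ, div_lt_iff₀ hτ]; linarith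
    linarith
  have hAle : ‖A‖ ≤ 48 / 7 * ρ * ‖w‖ := by
    calc ‖A‖ ≤ 48 / 7 / τ * ‖a - y‖ * ‖w‖ := hg
      _ ≤ 48 / 7 / τ * r * ‖w‖ := by gcongr
      _ = _ := by rw [hρ]; ring
  have hn2 : ⟪w - A, e⟫ ≤ ρ * ‖w‖ * ‖e‖ := by
    have h1 : ‖w - A‖ * ‖e‖ ^ 2 ≤ ‖w‖ * (‖e‖ * (2 * r)) := by
      rw [sq]; gcongr
    have h2 : 2 * τ * ⟪w - A, e⟫ ≤ 2 * τ * (ρ * ‖w‖ * ‖e‖) := by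
      calc _ ≤ _ := hnorm.trans h1
        _ = _ := by rw [← hρτ]; ring
    exact le_of_mul_le_mul_left h2 (by positivity)
  have hwle : ‖w‖ ≤ 8 * ρ * ‖e‖ := by
    rcases (norm_nonneg w).eq_or_lt with h | h
    · rw [← h]; positivity
    · have h1 : ‖A‖ * ‖e‖ ≤ 48 / 7 * ρ * ‖w‖ * ‖e‖ := by gcongr
      have h2 : 0 ≤ ρ * ‖w‖ * ‖e‖ := by positivity
      have : ‖w‖ * ‖w‖ ≤ ‖w‖ * (8 * ρ * ‖e‖) := by nlinarith
      exact le_of_mul_le_mul_left this h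
  have hPle : ‖e‖ * (1 - 8 * ρ) ≤ ‖P‖ := by
    apply le_of_sq_le_sq_aux _ (norm_nonneg _)
    have h1 : ‖w‖ ^ 2 ≤ (8 * ρ * ‖e‖) ^ 2 := by gcongr
    have h2 : 0 ≤ 8 * ρ * (1 - 8 * ρ) * ‖e‖ ^ 2 :=
      mul_nonneg (mul_nonneg (by positivity) (by linarith)) (by positivity)
    nlinarith
  have hPpos : 0 < ‖P‖ := lt_of_lt_of_le (mul_pos hepos (by linarith)) hPle
  refine ⟨(1 / ‖P‖) • P, Submodule.smul_mem _ _ hPT, ?_, ?_⟩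
  · rw [norm_smul, Real.norm_of_nonneg (by positivity)]; field_simp
  · rw [inner_smul_left, hPe]
    have : (starRingEnd ℝ) (1 / ‖P‖) * ‖P‖ ^ 2 = ‖P‖ := by
      simp only [conj_trivial]; field_simp
    rw [this, abs_of_pos hPpos, mul_div_assoc]
    exact hPle

end
end

section
/- Let M be a C² compact d-dimensional submanifold of ℝ^D without boundary with reach τ > 0, let 0 < σ < τ, y ∈ M, and r > 0 with r + σ ≤ τ/8. Then Vol(M_σ ∩ B(y,r)) ≤ (1 + σ/τ)^d · (1 + (2(r+σ)/(τ − 2(r+σ)))²)^{d/2} · Vol(B_d(0, r+σ)) · Vol(B_{D−d}(0,σ)), where M_σ = {y' ∈ ℝ^D : dist(y', M) < σ}, Vol denotes Lebesgue measure on ℝ^D, and B_k(0,ρ) the Euclidean ball of radius ρ in ℝ^k. -/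
open MeasureTheory ProbabilityTheory Metric
open scoped ENNReal RealInnerProductSpace BigOperators Classical Matrix

noncomputable section

set_option linter.unusedSectionVars false

section ReachAbstract

variable {E : Type*} [NormedAddCommGroup E] [InnerProductSpace ℝ E] [FiniteDimensional ℝ E]

/-- Uniqueness of nearest points in the open `τ`-tube. -/
def UniqNear (M : Set E) (τ : ℝ) : Prop :=
  ∀ z, infDist z M < τ → ∀ x ∈ M, ∀ x' ∈ M, dist z x = infDist z M → dist z x' = infDist z M →
    x = x'

lemma near_cont {M : Set E} (hM : IsCompact M) {τ : ℝ} (hU : UniqNear M τ)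
    {q m : E} (hq : infDist q M < τ) (hm : m ∈ M) (hqm : dist q m = infDist q M)
    {ε : ℝ} (hε : 0 < ε) :
    ∀ᶠ q' in nhds q, ∀ m' ∈ M, dist q' m' = infDist q' M → dist m' m < ε := by
  set K := M \ ball m ε with hK
  have hKc : IsCompact K := hM.diff isOpen_ball
  by_cases hne : K.Nonempty
  · obtain ⟨k, hk, hkd⟩ := hKc.exists_infDist_eq_dist hne q
    have hlt : infDist q M < infDist q K := by
      rw [hkd]
      refine lt_of_le_of_ne (infDist_le_dist_of_mem hk.1) ?_
      intro h
      have := hU q hq k hk.1 m hm h.symm hqm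
      exact hk.2 (by simpa [this] using hε)
    have h1 : ∀ᶠ q' in nhds q, infDist q' M < infDist q' K :=
      (continuous_infDist_pt M).continuousAt.eventually_lt (continuous_infDist_pt K).continuousAt hlt
    filter_upwards [h1] with q' hq' m' hm' hd
    by_contra hcon
    have : m' ∈ K := ⟨hm', by simpa using hcon⟩
    have := infDist_le_dist_of_mem (x := q') this
    linarith
  · refine Filter.Eventually.of_forall fun q' m' hm' _ => ?_
    by_contra hcon
    exact hne ⟨m', hm', by simpa using hcon⟩

lemma dist_increases {M : Set E} (hM : IsCompact M) (hMn : M.Nonempty) {τ : ℝ} (hU : UniqNear M τ)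
    {q m v : E} (hq : infDist q M < τ) (hm : m ∈ M) (hqm : dist q m = infDist q M)
    (hv : 0 < ⟪v, q - m⟫) :
    ∀ᶠ h in nhdsWithin (0:ℝ) (Set.Ioi 0), infDist q M < infDist (q + h • v) M := by
  have hvne : v ≠ 0 := by rintro rfl; simp at hv
  have hvn : 0 < ‖v‖ := norm_pos_iff.mpr hvne
  have h1 := near_cont hM hU hq hm hqm (ε := ⟪v, q - m⟫ / ‖v‖) (by positivity)
  have h2 : Filter.Tendsto (fun h : ℝ => q + h • v) (nhdsWithin 0 (Set.Ioi 0)) (nhds q) := by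
    have : Continuous fun h : ℝ => q + h • v := by fun_prop
    have := this.tendsto 0
    simp only [zero_smul, add_zero] at this
    exact this.mono_left nhdsWithin_le_nhds
  filter_upwards [h2.eventually h1, self_mem_nhdsWithin] with h hh hpos
  have hpos : 0 < h := hpos
  obtain ⟨m', hm', hd⟩ := hM.exists_infDist_eq_dist hMn (q + h • v)
  have h3 := hh m' hm' hd.symm
  have h4 : ⟪v, m' - m⟫ ≤ ‖v‖ * ‖m' - m‖ := real_inner_le_norm _ _
  rw [dist_eq_norm, lt_div_iff₀ hvn] at h3
  have h5 : 0 < ⟪v, q - m'⟫ := by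
    have : ⟪v, q - m'⟫ = ⟪v, q - m⟫ - ⟪v, m' - m⟫ := by rw [← inner_sub_right]; congr 1; abel
    rw [this]; nlinarith
  rw [hd]
  refine lt_of_le_of_lt (infDist_le_dist_of_mem hm') ?_
  rw [dist_eq_norm, dist_eq_norm]
  refine lt_of_pow_lt_pow_left₀ 2 (norm_nonneg _) ?_
  have h6 : q + h • v - m' = (q - m') + h • v := by abel
  rw [h6, norm_add_sq_real, inner_smul_right, real_inner_comm]
  have := mul_pos hpos h5
  have := sq_nonneg ‖h • v‖
  linarith

lemma ext_step {M : Set E} (hM : IsCompact M) (hMn : M.Nonempty) {τ : ℝ} (hU : UniqNear M τ)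
    {p x : E} {T ε : ℝ} (hx : x ∈ M) (hpx : dist p x = T) (hpM : infDist p M = T)
    (hT : 0 < T) (hε : 0 < ε) (hεT : ε < T) (hTτ : T + ε < τ) :
    infDist (p + (ε / T) • (p - x)) M = T + ε := by
  obtain ⟨q, hq, hmax⟩ := (isCompact_closedBall p ε).exists_isMaxOn
    ⟨p, mem_closedBall_self hε.le⟩ (continuous_infDist_pt M).continuousOn
  have hmax' : ∀ z ∈ closedBall p ε, infDist z M ≤ infDist q M := fun z hz => hmax hz
  have hqT : T ≤ infDist q M := by
    have := hmax' p (mem_closedBall_self hε.le); linarith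
  have hqT2 : infDist q M ≤ T + ε := by
    have := infDist_le_infDist_add_dist (s := M) (x := q) (y := p)
    have h2 : dist q p ≤ ε := hq
    linarith
  obtain ⟨m, hm, hqm⟩ := hM.exists_infDist_eq_dist hMn q
  set e := q - p with he
  set w := q - m with hw
  have hwn : ‖w‖ = infDist q M := by rw [hqm, dist_eq_norm]
  have hwpos : 0 < ‖w‖ := by linarith
  have hen : ‖e‖ ≤ ε := by rw [he, ← dist_eq_norm]; exact hq
  have key : ∀ v, 0 < ⟪v, w⟫ → ¬ (∀ᶠ h in nhdsWithin (0:ℝ) (Set.Ioi 0), ‖e + h • v‖ ≤ ε) := by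
    intro v hv hcon
    have h1 := dist_increases hM hMn hU (lt_of_le_of_lt hqT2 hTτ) hm hqm.symm hv
    obtain ⟨h, h2, h3⟩ := (h1.and hcon).exists
    have : q + h • v ∈ closedBall p ε := by
      rw [mem_closedBall, dist_eq_norm]
      have h4 : q + h • v - p = e + h • v := by rw [he]; abel
      rw [h4]; exact h3
    have := hmax' _ this
    linarith
  have hcontv : ∀ v : E, Filter.Tendsto (fun h : ℝ => ‖e + h • v‖) (nhdsWithin 0 (Set.Ioi 0))
      (nhds ‖e‖) := by
    intro v
    have : Continuous fun h : ℝ => ‖e + h • v‖ := by fun_prop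
    have := this.tendsto 0
    simp only [zero_smul, add_zero] at this
    exact this.mono_left nhdsWithin_le_nhds
  have hee : ‖e‖ = ε := by
    by_contra hne
    have hlt : ‖e‖ < ε := lt_of_le_of_ne hen hne
    refine key w ?_ (((hcontv w).eventually_lt_const hlt).mono fun _ h => h.le)
    rw [real_inner_self_eq_norm_sq]; positivity
  have hew : ⟪e, w⟫ = ‖e‖ * ‖w‖ := by
    by_contra hne
    have hlt : ⟪e, w⟫ < ε * ‖w‖ := by
      rw [← hee]; exact lt_of_le_of_ne (real_inner_le_norm _ _) hne
    set v := ε • w - ‖w‖ • e with hv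
    have hvw : 0 < ⟪v, w⟫ := by
      rw [hv, inner_sub_left, inner_smul_left, inner_smul_left, real_inner_self_eq_norm_sq]
      simp only [conj_trivial]
      nlinarith
    have hev : ⟪e, v⟫ < 0 := by
      rw [hv, inner_sub_right, inner_smul_right, inner_smul_right, real_inner_self_eq_norm_sq, hee]
      nlinarith
    refine key v hvw ?_
    have h7 : Filter.Tendsto (fun h : ℝ => 2 * ⟪e, v⟫ + h * ‖v‖ ^ 2) (nhdsWithin 0 (Set.Ioi 0))
        (nhds (2 * ⟪e, v⟫)) := by
      have : Continuous fun h : ℝ => 2 * ⟪e, v⟫ + h * ‖v‖ ^ 2 := by fun_prop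
      have := this.tendsto 0
      simp only [zero_mul, add_zero] at this
      exact this.mono_left nhdsWithin_le_nhds
    filter_upwards [h7.eventually_lt_const (show 2 * ⟪e, v⟫ < 0 by linarith), self_mem_nhdsWithin]
      with h h8 h9
    have h9 : 0 < h := h9
    refine le_of_sq_le_sq ?_ hε.le
    rw [norm_add_sq_real, inner_smul_right, norm_smul, mul_pow, Real.norm_eq_abs, sq_abs, hee]
    nlinarith
  have hpar : ‖w‖ • e = ε • w := by
    have := inner_eq_norm_mul_iff_real.mp hew
    rw [this, hee]
  have hpe : e = (ε / ‖w‖) • w := by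
    rw [div_eq_inv_mul, mul_smul, ← hpar, smul_smul, inv_mul_cancel₀ hwpos.ne', one_smul]
  have hpm : p - m = (1 - ε / ‖w‖) • w := by
    have : p - m = w - e := by rw [hw, he]; abel
    rw [this, hpe, sub_smul, one_smul, ← hpe]
  have hratio : ε / ‖w‖ < 1 := by rw [div_lt_one hwpos]; linarith
  have hpmn : dist p m = ‖w‖ - ε := by
    rw [dist_eq_norm, hpm, norm_smul, Real.norm_eq_abs, abs_of_pos (by linarith)]
    field_simp
  have hge : T ≤ dist p m := by rw [← hpM]; exact infDist_le_dist_of_mem hm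
  have hwT : ‖w‖ = T + ε := by linarith
  have hmx : m = x := hU p (by linarith) m hm x hx (by linarith) (by linarith)
  subst hmx
  have : p + (ε / T) • (p - m) = q := by
    have h1 : p = m + (p - m) := by abel
    have h2 : q = m + w := by rw [hw]; abel
    rw [h2]
    nth_rewrite 1 [h1]
    rw [add_assoc]
    congr 1
    rw [hpm, hwT, smul_smul, ← add_smul]
    have : (1 - ε / (T + ε)) + ε / T * (1 - ε / (T + ε)) = 1 := by
      have : T + ε ≠ 0 := by positivity
      field_simp
      ring
    rw [this, one_smul]
  rw [this, ← hwn, hwT]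

lemma ext_ray {M : Set E} (hM : IsCompact M) (hMn : M.Nonempty) {τ : ℝ} (hU : UniqNear M τ)
    {x n : E} {t0 t1 : ℝ} (hx : x ∈ M) (hn : ‖n‖ = 1) (ht0 : 0 < t0) (ht1 : t1 < τ)
    (h0 : infDist (x + t0 • n) M = t0) (h01 : t0 ≤ t1) : infDist (x + t1 • n) M = t1 := by
  have hcont : Continuous fun t : ℝ => infDist (x + t • n) M :=
    (continuous_infDist_pt M).comp (by fun_prop)
  have hcl : IsClosed ({t : ℝ | infDist (x + t • n) M = t} ∩ Set.Icc t0 t1) :=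
    (isClosed_eq hcont continuous_id).inter isClosed_Icc
  have := hcl.Icc_subset_of_forall_exists_gt h0 ?_
  · exact this ⟨h01, le_rfl⟩
  · rintro t ⟨ht, ht2⟩ t' ht'
    have ht : infDist (x + t • n) M = t := ht
    have htpos : 0 < t := lt_of_lt_of_le ht0 ht2.1
    have ht' : t < t' := ht'
    set ε := min (t / 2) (min (t' - t) ((t1 - t) / 2)) with hε
    have e1 : ε ≤ t / 2 := min_le_left _ _
    have e2 : ε ≤ t' - t := (min_le_right _ _).trans (min_le_left _ _)
    have e3 : ε ≤ (t1 - t) / 2 := (min_le_right _ _).trans (min_le_right _ _)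
    have e0 : 0 < ε := by
      have := ht2.2
      refine lt_min (by linarith) (lt_min (by linarith) (by linarith))
    refine ⟨t + ε, ?_, by constructor <;> linarith⟩
    have hd : dist (x + t • n) x = t := by
      rw [dist_eq_norm, add_sub_cancel_left, norm_smul, hn, mul_one, Real.norm_eq_abs,
        abs_of_pos htpos]
    have := ext_step hM hMn hU hx hd ht htpos e0 (by linarith) (by linarith [ht2.2])
    rw [add_sub_cancel_left, smul_smul, div_mul_cancel₀ _ htpos.ne', add_assoc, ← add_smul] at this
    exact this

/-- The tangent ball property. -/
lemma ball_prop {M : Set E} (hM : IsCompact M) (hMn : M.Nonempty) {τ : ℝ} (hU : UniqNear M τ)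
    {x n : E} (hx : x ∈ M) {t0 : ℝ} (ht0 : 0 < t0) (ht0n : t0 * ‖n‖ < τ)
    (h0 : infDist (x + t0 • n) M = t0 * ‖n‖) {m : E} (hm : m ∈ M) :
    2 * τ * ⟪n, m - x⟫ ≤ ‖n‖ * ‖m - x‖ ^ 2 := by
  by_cases hn0 : n = 0
  · simp [hn0]
  have hnp : 0 < ‖n‖ := norm_pos_iff.mpr hn0
  set n' := ‖n‖⁻¹ • n with hn'
  have hn1 : ‖n'‖ = 1 := by rw [hn', norm_smul, norm_inv, norm_norm, inv_mul_cancel₀ hnp.ne']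
  have hnn : n = ‖n‖ • n' := by rw [hn', smul_smul, mul_inv_cancel₀ hnp.ne', one_smul]
  have h0' : infDist (x + (t0 * ‖n‖) • n') M = t0 * ‖n‖ := by
    rw [mul_smul, ← hnn, h0]
  have hT : 0 < t0 * ‖n‖ := by positivity
  have key : ∀ t, t0 * ‖n‖ ≤ t → t < τ → 2 * t * ⟪n', m - x⟫ ≤ ‖m - x‖ ^ 2 := by
    intro t ht htτ
    have h1 := ext_ray hM hMn hU hx hn1 hT htτ h0' ht
    have h2 : t ≤ dist (x + t • n') m := by
      calc t = _ := h1.symm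
        _ ≤ _ := infDist_le_dist_of_mem hm
    have h3 : x + t • n' - m = t • n' - (m - x) := by abel
    have htp : 0 ≤ t := by linarith
    have h4 : t ^ 2 ≤ ‖t • n' - (m - x)‖ ^ 2 := by
      rw [← h3, ← dist_eq_norm]; exact pow_le_pow_left₀ htp h2 2
    rw [norm_sub_sq_real, inner_smul_left, norm_smul, hn1, mul_one, Real.norm_eq_abs, sq_abs] at h4
    simp only [conj_trivial] at h4
    linarith
  have key2 : 2 * τ * ⟪n', m - x⟫ ≤ ‖m - x‖ ^ 2 := by
    have hc : Continuous fun t : ℝ => 2 * t * ⟪n', m - x⟫ := by fun_prop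
    have := (hc.tendsto τ).mono_left (nhdsWithin_le_nhds (s := Set.Iio τ))
    refine le_of_tendsto this ?_
    have hmem : Set.Ioo (t0 * ‖n‖) τ ∈ nhdsWithin τ (Set.Iio τ) := Ioo_mem_nhdsLT ht0n
    filter_upwards [hmem] with t ht
    exact key t ht.1.le ht.2
  rw [hnn, inner_smul_left, norm_smul, norm_norm, hn1, mul_one]
  simp only [conj_trivial]
  nlinarith

lemma ball_prop_near {M : Set E} (hM : IsCompact M) (hMn : M.Nonempty) {τ : ℝ} (hU : UniqNear M τ)
    {x z : E} (hx : x ∈ M) (hz : infDist z M < τ) (hzx : dist z x = infDist z M)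
    {m : E} (hm : m ∈ M) :
    2 * τ * ⟪z - x, m - x⟫ ≤ ‖z - x‖ * ‖m - x‖ ^ 2 := by
  refine ball_prop hM hMn hU hx one_pos ?_ ?_ hm
  · rw [one_mul, ← dist_eq_norm, hzx]; exact hz
  · rw [one_smul, one_mul, ← dist_eq_norm, hzx, add_sub_cancel]

lemma proj_lip_s13 {M : Set E} (hM : IsCompact M) (hMn : M.Nonempty) {τ ρ : ℝ} (hU : UniqNear M τ)
    (hρ : ρ < τ) (hτ : 0 < τ)
    {x z x' z' : E} (hx : x ∈ M) (hz : infDist z M ≤ ρ) (hzx : dist z x = infDist z M)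
    (hx' : x' ∈ M) (hz' : infDist z' M ≤ ρ) (hzx' : dist z' x' = infDist z' M) :
    (1 - ρ / τ) * ‖x' - x‖ ≤ ‖z' - z‖ := by
  have h1 := ball_prop_near hM hMn hU hx (hz.trans_lt hρ) hzx hx'
  have h2 := ball_prop_near hM hMn hU hx' (hz'.trans_lt hρ) hzx' hx
  rw [← dist_eq_norm z x, hzx] at h1
  rw [← dist_eq_norm z' x', hzx', norm_sub_rev x x'] at h2
  have h3 : ⟪z - x, x' - x⟫ + ⟪z' - x', x - x'⟫ = ‖x' - x‖ ^ 2 - ⟪z' - z, x' - x⟫ := by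
    rw [← real_inner_self_eq_norm_sq, ← inner_sub_left, ← neg_sub x' x, inner_neg_right,
      ← sub_eq_add_neg, ← inner_sub_left]
    congr 1; abel
  have h4 : ⟪z' - z, x' - x⟫ ≤ ‖z' - z‖ * ‖x' - x‖ := real_inner_le_norm _ _
  have h5 : 2 * τ * (‖x' - x‖ ^ 2 - ‖z' - z‖ * ‖x' - x‖) ≤ 2 * ρ * ‖x' - x‖ ^ 2 := by
    nlinarith [sq_nonneg ‖x' - x‖]
  have h6 : (τ - ρ) * ‖x' - x‖ * ‖x' - x‖ ≤ τ * ‖z' - z‖ * ‖x' - x‖ := by nlinarith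
  have h7 : (τ - ρ) * ‖x' - x‖ ≤ τ * ‖z' - z‖ := by
    rcases (norm_nonneg (x' - x)).eq_or_lt with h | h
    · rw [← h]; simp; positivity
    · exact le_of_mul_le_mul_right h6 h
  have : (1 - ρ / τ) * ‖x' - x‖ = ((τ - ρ) * ‖x' - x‖) / τ := by field_simp
  rw [this, div_le_iff₀ hτ]; linarith

end ReachAbstract

set_option linter.unusedSectionVars false

section LocalGraph

variable {E : Type*} [NormedAddCommGroup E] [InnerProductSpace ℝ E] [FiniteDimensional ℝ E]

/-- `M` is near `x` the graph of a `C²` map `f` over `T`, tangent to `T` at `x`. -/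
structure LG (M : Set E) (x : E) (T : Submodule ℝ E) (f : T → Tᗮ) (ε : ℝ) : Prop where
  pos : 0 < ε
  cd : ContDiff ℝ 2 f
  f0 : f 0 = 0
  df0 : fderiv ℝ f 0 = 0
  eq : M ∩ ball x ε = (Set.range fun v : T => x + (v : E) + (f v : E)) ∩ ball x ε

variable {M : Set E} {x : E} {T : Submodule ℝ E} {f : T → Tᗮ} {ε : ℝ}

lemma LG.diff (h : LG M x T f ε) : Differentiable ℝ f := h.cd.differentiable (by norm_num)

lemma LG.dcd (h : LG M x T f ε) : ContDiff ℝ 1 (fderiv ℝ f) :=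
  h.cd.fderiv_right (by norm_num)

lemma LG.mem_self (h : LG M x T f ε) : x ∈ M := by
  have : x ∈ M ∩ ball x ε := by
    rw [h.eq]; exact ⟨⟨0, by simp [h.f0]⟩, mem_ball_self h.pos⟩
  exact this.1

lemma LG.mem (h : LG M x T f ε) : ∃ δ > 0, ∀ u : T, ‖u‖ < δ → x + (u : E) + (f u : E) ∈ M := by
  have hc : Continuous fun u : T => x + (u : E) + (f u : E) := by
    have := h.diff.continuous; fun_prop
  have h1 : ∀ᶠ u : T in nhds (0 : T), x + (u : E) + (f u : E) ∈ ball x ε := by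
    refine hc.continuousAt.eventually_mem ?_
    simp [h.f0, ball_mem_nhds x h.pos]
  obtain ⟨δ, hδ, hh⟩ := Metric.eventually_nhds_iff.mp h1
  refine ⟨δ, hδ, fun u hu => ?_⟩
  have h2 := hh (y := u) (by simpa using hu)
  have : x + (u : E) + (f u : E) ∈ M ∩ ball x ε := by
    rw [h.eq]; exact ⟨⟨u, rfl⟩, h2⟩
  exact this.1

lemma norm_sq_split (u : T) (w : Tᗮ) : ‖(u : E) + (w : E)‖ ^ 2 = ‖u‖ ^ 2 + ‖w‖ ^ 2 := by
  have := norm_add_sq_eq_norm_sq_add_norm_sq_real (x := (u : E)) (y := (w : E))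
    (Submodule.inner_right_of_mem_orthogonal u.2 w.2)
  rw [sq, sq, sq, this]; rfl

lemma norm_le_split (u : T) (w : Tᗮ) : ‖u‖ ≤ ‖(u : E) + (w : E)‖ := by
  refine le_of_sq_le_sq ?_ (norm_nonneg _)
  rw [norm_sq_split]; nlinarith [sq_nonneg ‖w‖]

lemma norm_le_split' (u : T) (w : Tᗮ) : ‖w‖ ≤ ‖(u : E) + (w : E)‖ := by
  refine le_of_sq_le_sq ?_ (norm_nonneg _)
  rw [norm_sq_split]; nlinarith [sq_nonneg ‖u‖]

lemma LG.repr (h : LG M x T f ε) {x' : E} (hx' : x' ∈ M) (hd : dist x' x < ε) :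
    ∃ u : T, x' = x + (u : E) + (f u : E) ∧ ‖u‖ ≤ ‖x' - x‖ := by
  have : x' ∈ M ∩ ball x ε := ⟨hx', hd⟩
  rw [h.eq] at this
  obtain ⟨⟨u, hu⟩, -⟩ := this
  replace hu : x + (u : E) + (f u : E) = x' := hu
  refine ⟨u, hu.symm, ?_⟩
  have : x' - x = (u : E) + (f u : E) := by rw [← hu]; abel
  rw [this]
  exact norm_le_split u (f u)

lemma LG.quad (h : LG M x T f ε) : ∃ C > 0, ∃ δ > 0, ∀ u : T, ‖u‖ < δ → ‖f u‖ ≤ C * ‖u‖ ^ 2 := by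
  have h1 : DifferentiableAt ℝ (fderiv ℝ f) 0 := (h.dcd.differentiable (by norm_num)) 0
  have h2 := HasFDerivAt.isBigO_sub (𝕜 := ℝ) (E := T) (F := T →L[ℝ] Tᗮ) h1.hasFDerivAt
  obtain ⟨C, hC, h3⟩ := h2.exists_pos
  rw [Asymptotics.isBigOWith_iff] at h3
  obtain ⟨δ, hδ, hh⟩ := Metric.eventually_nhds_iff.mp h3
  refine ⟨C, hC, δ, hδ, fun u hu => ?_⟩
  have h4 : ∀ v ∈ closedBall (0 : T) ‖u‖, ‖fderiv ℝ f v‖ ≤ C * ‖u‖ := by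
    intro v hv
    have hv' : ‖v‖ ≤ ‖u‖ := by simpa using hv
    have := hh (y := v) (by simpa using lt_of_le_of_lt hv' hu)
    rw [h.df0, sub_zero, sub_zero] at this
    exact this.trans (by gcongr)
  have := (convex_closedBall (0 : T) ‖u‖).norm_image_sub_le_of_norm_fderiv_le
    (fun v _ => h.diff v) h4 (x := 0) (y := u) (by simp) (by simp)
  rw [h.f0, sub_zero, sub_zero] at this
  calc _ ≤ _ := this
    _ = _ := by ring

lemma LG.normal (h : LG M x T f ε) {τ : ℝ} (hτ : 0 < τ) {n : E} (hn : n ∈ Tᗮ) :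
    ∃ t0 > 0, t0 * ‖n‖ < τ ∧ infDist (x + t0 • n) M = t0 * ‖n‖ := by
  obtain ⟨C, hC, δ, hδ, hq⟩ := h.quad
  -- quadratic bound on the whole of `M`
  obtain ⟨K, hK, hKM⟩ : ∃ K > 0, ∀ m ∈ M, ⟪n, m - x⟫ ≤ K * ‖m - x‖ ^ 2 := by
    set r := min ε δ with hr
    have hrp : 0 < r := lt_min h.pos hδ
    refine ⟨(C + 1 / r) * (‖n‖ + 1), by positivity, fun m hm => ?_⟩
    have hin : ⟪n, m - x⟫ ≤ ‖n‖ * ‖m - x‖ := real_inner_le_norm _ _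
    by_cases hmr : ‖m - x‖ < r
    · obtain ⟨u, hu, hun⟩ := h.repr hm (by rw [dist_eq_norm]; exact hmr.trans_le (min_le_left _ _))
      have h1 := hq u (lt_of_le_of_lt hun (hmr.trans_le (min_le_right _ _)))
      have h2 : ⟪n, m - x⟫ = ⟪n, (f u : E)⟫ := by
        have : m - x = (u : E) + (f u : E) := by rw [hu]; abel
        rw [this, inner_add_right, Submodule.inner_left_of_mem_orthogonal u.2 hn, zero_add]
      have h3 : ⟪n, (f u : E)⟫ ≤ ‖n‖ * ‖f u‖ := real_inner_le_norm _ _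
      rw [h2]
      have h4 : ‖u‖ ^ 2 ≤ ‖m - x‖ ^ 2 := by gcongr
      calc _ ≤ ‖n‖ * (C * ‖m - x‖ ^ 2) := by
            refine h3.trans ?_
            gcongr
            exact h1.trans (by gcongr)
        _ ≤ ((‖n‖ + 1) * (C + 1 / r)) * ‖m - x‖ ^ 2 := by
            rw [← mul_assoc]
            gcongr <;> [skip; skip]
            · linarith
            · have : 0 < 1 / r := by positivity
              linarith
        _ = _ := by ring
    · push Not at hmr
      have h5 : ‖m - x‖ ≤ (1 / r) * ‖m - x‖ ^ 2 := by
        rw [one_div, ← div_eq_inv_mul, le_div_iff₀ hrp]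
        nlinarith [norm_nonneg (m - x)]
      calc _ ≤ ‖n‖ * ((1 / r) * ‖m - x‖ ^ 2) := hin.trans (by gcongr)
        _ ≤ ((‖n‖ + 1) * (C + 1 / r)) * ‖m - x‖ ^ 2 := by
            rw [← mul_assoc]
            gcongr <;> [skip; skip]
            · linarith
            · linarith
        _ = _ := by ring
  set t0 := min (1 / (2 * K)) (τ / (2 * (‖n‖ + 1))) with ht0
  have ht0p : 0 < t0 := lt_min (by positivity) (by positivity)
  have hnn := norm_nonneg n
  refine ⟨t0, ht0p, ?_, ?_⟩
  · calc t0 * ‖n‖ ≤ τ / (2 * (‖n‖ + 1)) * ‖n‖ := by gcongr; exact min_le_right _ _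
      _ < τ := by
        rw [div_mul_eq_mul_div, div_lt_iff₀ (by positivity)]
        nlinarith
  · have hdx : dist (x + t0 • n) x = t0 * ‖n‖ := by
      rw [dist_eq_norm, add_sub_cancel_left, norm_smul, Real.norm_eq_abs, abs_of_pos ht0p]
    apply le_antisymm
    · rw [← hdx]; exact infDist_le_dist_of_mem h.mem_self
    · rw [le_infDist ⟨x, h.mem_self⟩]
      intro m hm
      rw [dist_eq_norm]
      refine le_of_sq_le_sq ?_ (norm_nonneg _)
      have h3 : x + t0 • n - m = t0 • n - (m - x) := by abel
      rw [h3, norm_sub_sq_real, inner_smul_left, norm_smul, Real.norm_eq_abs, abs_of_pos ht0p]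
      simp only [conj_trivial]
      have h6 := hKM m hm
      have h7 : 2 * t0 * K ≤ 1 := by
        have : t0 ≤ 1 / (2 * K) := min_le_left _ _
        rw [le_div_iff₀ (by positivity)] at this
        linarith
      have h8 : 2 * (t0 * ⟪n, m - x⟫) ≤ 1 * ‖m - x‖ ^ 2 := by
        calc 2 * (t0 * ⟪n, m - x⟫) ≤ 2 * (t0 * (K * ‖m - x‖ ^ 2)) := by gcongr
          _ = (2 * t0 * K) * ‖m - x‖ ^ 2 := by ring
          _ ≤ _ := by gcongr
      linarith

lemma LG.ball_ineq (h : LG M x T f ε) (hM : IsCompact M) {τ : ℝ} (hτ : 0 < τ) (hU : UniqNear M τ)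
    {n : E} (hn : n ∈ Tᗮ) {m : E} (hm : m ∈ M) :
    2 * τ * ⟪n, m - x⟫ ≤ ‖n‖ * ‖m - x‖ ^ 2 := by
  obtain ⟨t0, h0, h1, h2⟩ := h.normal hτ hn
  exact ball_prop hM ⟨m, hm⟩ hU h.mem_self h0 h1 h2 hm

/-- The second fundamental form is bounded by `1/τ` on the diagonal. -/
lemma LG.snd_diag (h : LG M x T f ε) (hM : IsCompact M) {τ : ℝ} (hτ : 0 < τ) (hU : UniqNear M τ)
    (n : Tᗮ) (u : T) :
    ⟪n, fderiv ℝ (fderiv ℝ f) 0 u u⟫ ≤ ‖n‖ * ‖u‖ ^ 2 / τ := by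
  set A := fderiv ℝ (fderiv ℝ f) 0 with hA
  by_contra hcon
  push Not at hcon
  set κ := (‖n‖ * ‖u‖ ^ 2 / τ + ⟪n, A u u⟫) / 4 with hκ
  have hκ1 : 2 * κ < ⟪n, A u u⟫ := by linarith
  have hκ2 : ‖n‖ * ‖u‖ ^ 2 / τ < 2 * κ := by linarith
  obtain ⟨C, hC, δ, hδ, hq⟩ := h.quad
  obtain ⟨δ', hδ', hmem⟩ := h.mem
  have hline : Filter.Tendsto (fun t : ℝ => t • u) (nhds 0) (nhds 0) := by
    have : Continuous fun t : ℝ => t • u := by fun_prop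
    simpa using this.tendsto 0
  set ψ : ℝ → ℝ := fun t => κ * t ^ 2 - ⟪n, f (t • u)⟫ with hψ
  have hψ0 : ψ 0 = 0 := by simp [hψ, h.f0]
  have hψnn : ∀ᶠ t in nhds (0:ℝ), 0 ≤ ψ t := by
    have e1 := hline.eventually (ball_mem_nhds 0 hδ)
    have e2 := hline.eventually (ball_mem_nhds 0 hδ')
    have e3 : ∀ᶠ t in nhds (0:ℝ), ‖n‖ * ‖u‖ ^ 2 / τ + ‖n‖ * (C ^ 2 * ‖u‖ ^ 4 * t ^ 2) / τ < 2 * κ := by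
      have hc : Continuous fun t : ℝ => ‖n‖ * ‖u‖ ^ 2 / τ + ‖n‖ * (C ^ 2 * ‖u‖ ^ 4 * t ^ 2) / τ := by
        fun_prop
      refine hc.continuousAt.eventually_lt continuousAt_const ?_
      simpa using hκ2
    filter_upwards [e1, e2, e3] with t h1 h2 h3
    have h4 := hq (t • u) (by simpa using h1)
    have h5 := hmem (t • u) (by simpa using h2)
    have h6 := h.ball_ineq hM hτ hU n.2 h5
    have h7 : x + ((t • u : T) : E) + (f (t • u) : E) - x = ((t • u : T) : E) + (f (t • u) : E) := by
      abel
    rw [h7, norm_sq_split, inner_add_right,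
      Submodule.inner_left_of_mem_orthogonal (t • u : T).2 n.2, zero_add] at h6
    have h6' : 2 * τ * ⟪n, f (t • u)⟫ ≤ ‖n‖ * (‖t • u‖ ^ 2 + ‖f (t • u)‖ ^ 2) := h6
    have h8 : ‖t • u‖ ^ 2 = t ^ 2 * ‖u‖ ^ 2 := by
      rw [norm_smul, mul_pow, Real.norm_eq_abs, sq_abs]
    have h9 : ‖f (t • u)‖ ^ 2 ≤ (C * (t ^ 2 * ‖u‖ ^ 2)) ^ 2 := by
      rw [← h8]; gcongr
    rw [h8] at h6'
    have h10 : ⟪n, f (t • u)⟫ ≤ t ^ 2 / 2 *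
        (‖n‖ * ‖u‖ ^ 2 / τ + ‖n‖ * (C ^ 2 * ‖u‖ ^ 4 * t ^ 2) / τ) := by
      have e : t ^ 2 / 2 * (‖n‖ * ‖u‖ ^ 2 / τ + ‖n‖ * (C ^ 2 * ‖u‖ ^ 4 * t ^ 2) / τ)
        = (‖n‖ * (t ^ 2 * ‖u‖ ^ 2 + (C * (t ^ 2 * ‖u‖ ^ 2)) ^ 2)) / (2 * τ) := by
        field_simp; try ring
      rw [e, le_div_iff₀ (by positivity)]
      have := mul_le_mul_of_nonneg_left h9 (norm_nonneg n)
      linarith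
    have h11 : t ^ 2 / 2 * (‖n‖ * ‖u‖ ^ 2 / τ + ‖n‖ * (C ^ 2 * ‖u‖ ^ 4 * t ^ 2) / τ)
      ≤ t ^ 2 / 2 * (2 * κ) := by gcongr
    simp only [hψ]
    linarith
  have hd1 : ∀ t, HasDerivAt ψ (2 * κ * t - ⟪n, fderiv ℝ f (t • u) u⟫) t := by
    intro t
    have a1 : HasDerivAt (fun t : ℝ => t • u) u t := by
      simpa using (hasDerivAt_id t).smul_const u
    have a2 : HasDerivAt (fun t : ℝ => f (t • u)) (fderiv ℝ f (t • u) u) t :=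
      (h.diff (t • u)).hasFDerivAt.comp_hasDerivAt t a1
    have a3 := (hasDerivAt_const t n).inner ℝ a2
    have a4 : HasDerivAt (fun t : ℝ => κ * t ^ 2) (2 * κ * t) t := by
      have := (hasDerivAt_pow 2 t).const_mul κ
      refine this.congr_deriv ?_
      norm_num; ring
    refine (a4.sub a3).congr_deriv ?_
    simp
  have hd1' : deriv ψ = fun t => 2 * κ * t - ⟪n, fderiv ℝ f (t • u) u⟫ := funext fun t => (hd1 t).deriv
  have hd2 : deriv (deriv ψ) 0 = 2 * κ - ⟪n, A u u⟫ := by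
    rw [hd1']
    apply HasDerivAt.deriv
    have a1 : HasDerivAt (fun t : ℝ => t • u) u 0 := by
      simpa using (hasDerivAt_id (0:ℝ)).smul_const u
    have b0 : HasFDerivAt (fderiv ℝ f) A ((0:ℝ) • u) := by
      rw [zero_smul]
      exact ((h.dcd.differentiable (by norm_num)) 0).hasFDerivAt
    have a2 : HasDerivAt (fun t : ℝ => fderiv ℝ f (t • u)) (A u) 0 :=
      HasFDerivAt.comp_hasDerivAt (𝕜 := ℝ) (F := T) (E := T →L[ℝ] Tᗮ) 0 b0 a1
    have a2' := a2.clm_apply (hasDerivAt_const (0:ℝ) u)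
    have a3 := (hasDerivAt_const (0:ℝ) n).inner ℝ a2'
    have a4 : HasDerivAt (fun t : ℝ => 2 * κ * t) (2 * κ) 0 := by
      simpa using (hasDerivAt_id (0:ℝ)).const_mul (2 * κ)
    refine (a4.sub a3).congr_deriv ?_
    simp
  have hmax := isLocalMax_of_deriv_deriv_neg (f := ψ) (x₀ := 0) (by rw [hd2]; linarith)
    (by rw [hd1']; simp [h.df0]) (hd1 0).continuousAt
  have hz : ψ =ᶠ[nhds 0] fun _ => 0 := by
    filter_upwards [hmax, hψnn] with t h1 h2
    rw [hψ0] at h1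
    exact le_antisymm h1 h2
  have hz1 : deriv (deriv ψ) 0 = 0 := by
    rw [hz.deriv.deriv_eq]; simp
  linarith

/-- The second fundamental form is bounded by `1/τ`. -/
lemma LG.snd_bound (h : LG M x T f ε) (hM : IsCompact M) {τ : ℝ} (hτ : 0 < τ) (hU : UniqNear M τ)
    (u v : T) : ‖fderiv ℝ (fderiv ℝ f) 0 u v‖ ≤ ‖u‖ * ‖v‖ / τ := by
  set A := fderiv ℝ (fderiv ℝ f) 0 with hA
  have hsym : ∀ a b, A a b = A b a := by
    intro a b
    have := (h.cd.contDiffAt (x := 0)).isSymmSndFDerivAt (by simp)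
    exact this a b
  have hdiag := h.snd_diag hM hτ hU
  have hpol : ∀ (n : Tᗮ) (a b : T), 4 * ⟪n, A a b⟫ ≤ ‖n‖ / τ * (2 * ‖a‖ ^ 2 + 2 * ‖b‖ ^ 2) := by
    intro n a b
    have h1 := hdiag n (a + b)
    have h2 := hdiag (-n) (a - b)
    have h3 : 4 * ⟪n, A a b⟫ = ⟪n, A (a + b) (a + b)⟫ + ⟪-n, A (a - b) (a - b)⟫ := by
      simp only [map_add, map_sub, add_apply, sub_apply,
        inner_add_right, inner_sub_right, inner_neg_left, hsym b a]
      ring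
    have h4 := parallelogram_law_with_norm ℝ a b
    rw [norm_neg] at h2
    rw [h3]
    calc _ ≤ _ := add_le_add h1 h2
      _ = ‖n‖ / τ * (‖a + b‖ ^ 2 + ‖a - b‖ ^ 2) := by field_simp
      _ = _ := by rw [h4]; ring
  by_cases hu : u = 0
  · simp [hu]
  by_cases hv : v = 0
  · simp [hv]
  have hup : 0 < ‖u‖ := norm_pos_iff.mpr hu
  have hvp : 0 < ‖v‖ := norm_pos_iff.mpr hv
  have h1 := hpol (A u v) (‖v‖ • u) (‖u‖ • v)
  simp only [map_smul, smul_apply, inner_smul_right, norm_smul, norm_norm,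
    real_inner_self_eq_norm_sq] at h1
  rcases (norm_nonneg (A u v)).eq_or_lt with h0 | h0
  · rw [← h0]; positivity
  · have h2 : (‖u‖ * ‖v‖ * ‖A u v‖) * ‖A u v‖ ≤ (‖u‖ * ‖v‖ * ‖A u v‖) * (‖u‖ * ‖v‖ / τ) := by
      have e : ‖A u v‖ / τ * (2 * (‖v‖ * ‖u‖) ^ 2 + 2 * (‖u‖ * ‖v‖) ^ 2)
        = 4 * ((‖u‖ * ‖v‖ * ‖A u v‖) * (‖u‖ * ‖v‖ / τ)) := by field_simp; ring
      rw [e] at h1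
      nlinarith
    exact le_of_mul_le_mul_left h2 (by positivity)

lemma LG.fderiv_bound (h : LG M x T f ε) (hM : IsCompact M) {τ : ℝ} (hτ : 0 < τ)
    (hU : UniqNear M τ) {η : ℝ} (hη : 0 < η) :
    ∃ δ > 0, ∀ u : T, ‖u‖ < δ → ‖fderiv ℝ f u‖ ≤ (1 / τ + η) * ‖u‖ := by
  have h1 : DifferentiableAt ℝ (fderiv ℝ f) 0 := (h.dcd.differentiable (by norm_num)) 0
  have h2 := ((hasFDerivAt_iff_isLittleO_nhds_zero (𝕜 := ℝ) (E := T) (F := T →L[ℝ] Tᗮ)).mp h1.hasFDerivAt).def hη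
  obtain ⟨δ, hδ, hh⟩ := Metric.eventually_nhds_iff.mp h2
  refine ⟨δ, hδ, fun u hu => ?_⟩
  have h3 := hh (y := u) (by simpa using hu)
  rw [zero_add, h.df0, sub_zero] at h3
  have h4 : ‖fderiv ℝ (fderiv ℝ f) 0 u‖ ≤ 1 / τ * ‖u‖ := by
    refine ContinuousLinearMap.opNorm_le_bound _ (by positivity) fun v => ?_
    calc _ ≤ _ := h.snd_bound hM hτ hU u v
      _ = _ := by ring
  calc ‖fderiv ℝ f u‖ = ‖(fderiv ℝ f u - fderiv ℝ (fderiv ℝ f) 0 u) + fderiv ℝ (fderiv ℝ f) 0 u‖ := by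
        rw [sub_add_cancel]
    _ ≤ _ := norm_add_le (E := T →L[ℝ] Tᗮ) _ _
    _ ≤ η * ‖u‖ + 1 / τ * ‖u‖ := add_le_add h3 h4
    _ = _ := by ring

/-- The derivative of the graph parametrization along a line. -/
lemma LG.curve (h : LG M x T f ε) (u a : T) :
    HasDerivAt (fun t : ℝ => x + ((u + t • a : T) : E) + (f (u + t • a) : E))
      ((a : E) + (fderiv ℝ f u a : E)) 0 := by
  have a1 : HasDerivAt (fun t : ℝ => u + t • a) a 0 := by
    simpa using ((hasDerivAt_id (0:ℝ)).smul_const a).const_add u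
  have b0 : HasFDerivAt f (fderiv ℝ f u) (u + (0:ℝ) • a) := by
    rw [zero_smul, add_zero]; exact (h.diff u).hasFDerivAt
  have a2 : HasDerivAt (fun t : ℝ => f (u + t • a)) (fderiv ℝ f u a) 0 := b0.comp_hasDerivAt 0 a1
  have a3 := T.subtypeL.hasFDerivAt.comp_hasDerivAt (0:ℝ) a1
  have a4 := Tᗮ.subtypeL.hasFDerivAt.comp_hasDerivAt (0:ℝ) a2
  exact (a3.const_add x).add a4

/-- Nearest points are orthogonal. -/
lemma LG.orth (h : LG M x T f ε) {z : E} (hz : dist z x = infDist z M) : z - x ∈ Tᗮ := by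
  rw [Submodule.mem_orthogonal']
  intro a ha
  obtain ⟨a', rfl⟩ : ∃ a' : T, (a' : E) = a := ⟨⟨a, ha⟩, rfl⟩
  obtain ⟨δ, hδ, hmem⟩ := h.mem
  have hc := h.curve 0 a'
  have hd := ((hasDerivAt_const (0:ℝ) z).sub hc).norm_sq
  have hloc : IsLocalMin (fun t : ℝ => ‖z - (x + ((0 + t • a' : T) : E) +
      (f (0 + t • a') : E))‖ ^ 2) 0 := by
    have hline : Filter.Tendsto (fun t : ℝ => 0 + t • a') (nhds 0) (nhds 0) := by
      have : Continuous fun t : ℝ => 0 + t • a' := by fun_prop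
      simpa using this.tendsto 0
    filter_upwards [hline.eventually (ball_mem_nhds 0 hδ)] with t ht
    have h1 := hmem (0 + t • a') (by simpa using ht)
    have h2 := infDist_le_dist_of_mem (x := z) h1
    rw [← hz] at h2
    rw [dist_eq_norm, dist_eq_norm] at h2
    simp only [zero_smul, add_zero, h.f0, ZeroMemClass.coe_zero]
    gcongr
  have h0 := hloc.hasDerivAt_eq_zero hd
  simp [h.f0, h.df0] at h0
  linarith

/-- The tangent space at nearby points is the graph of the derivative. -/
lemma LG.tangent (h : LG M x T f ε) (hM : IsCompact M) {τ : ℝ} (hτ : 0 < τ) (hU : UniqNear M τ) :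
    ∃ δ > 0, ∀ u : T, ‖u‖ < δ → ∀ (T' : Submodule ℝ E) (f' : T' → T'ᗮ) (ε' : ℝ),
      LG M (x + (u : E) + (f u : E)) T' f' ε' → Module.finrank ℝ T' = Module.finrank ℝ T →
      (∀ a : T, (a : E) + (fderiv ℝ f u a : E) ∈ T') ∧
      (∀ v ∈ T', ∃ a : T, v = (a : E) + (fderiv ℝ f u a : E)) := by
  obtain ⟨δ, hδ, hmem⟩ := h.mem
  refine ⟨δ, hδ, fun u hu T' f' ε' h' hrank => ?_⟩
  have hfirst : ∀ a : T, (a : E) + (fderiv ℝ f u a : E) ∈ T' := by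
    intro a
    rw [← Submodule.orthogonal_orthogonal T', Submodule.mem_orthogonal]
    intro n hn
    have hc := h.curve u a
    set g : ℝ → E := fun t : ℝ => x + ((u + t • a : T) : E) + (f (u + t • a) : E) with hg
    have hg0 : g 0 = x + (u : E) + (f u : E) := by simp [hg]
    have hd1 := (hasDerivAt_const (0:ℝ) n).inner ℝ (hc.sub_const (g 0))
    have hd2 := (hc.sub_const (g 0)).norm_sq
    have hd := (hd1.const_mul (2 * τ)).sub (hd2.const_mul ‖n‖)
    have hloc : IsLocalMax (fun t : ℝ => 2 * τ * ⟪n, g t - g 0⟫ - ‖n‖ * ‖g t - g 0‖ ^ 2) 0 := by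
      have hline : Filter.Tendsto (fun t : ℝ => u + t • a) (nhds 0) (nhds u) := by
        have : Continuous fun t : ℝ => u + t • a := by fun_prop
        simpa using this.tendsto 0
      have hopen : {v : T | ‖v‖ < δ} ∈ nhds u := (isOpen_lt continuous_norm continuous_const).mem_nhds hu
      filter_upwards [hline.eventually hopen] with t ht
      have h1 := h'.ball_ineq hM hτ hU hn (hmem _ ht)
      rw [← hg0] at h1
      simp only [sub_self, inner_zero_right, norm_zero]
      have h1' : 2 * τ * ⟪n, g t - g 0⟫ ≤ ‖n‖ * ‖g t - g 0‖ ^ 2 := h1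
      linarith
    have h0 := hloc.hasDerivAt_eq_zero hd
    simp at h0
    rcases h0 with h0 | h0
    · exact absurd h0 hτ.ne'
    · exact h0
  refine ⟨hfirst, fun v hv => ?_⟩
  let φ : T →ₗ[ℝ] T' := (T.subtype + Tᗮ.subtype ∘ₗ (fderiv ℝ f u : T →ₗ[ℝ] Tᗮ)).codRestrict T'
    (fun a => by simpa using hfirst a)
  have hφ : ∀ a, (φ a : E) = (a : E) + (fderiv ℝ f u a : E) := fun a => by simp [φ]
  have hinj : Function.Injective φ := by
    rw [injective_iff_map_eq_zero]
    intro a ha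
    have h1 := norm_le_split a (fderiv ℝ f u a)
    rw [← hφ, ha] at h1
    simpa using h1
  have hsurj := (LinearMap.injective_iff_surjective_of_finrank_eq_finrank hrank.symm).mp hinj
  obtain ⟨a, ha⟩ := hsurj ⟨v, hv⟩
  exact ⟨a, by rw [← hφ, ha]⟩

end LocalGraph

section Angle

variable {E : Type*} [NormedAddCommGroup E] [InnerProductSpace ℝ E] [FiniteDimensional ℝ E]

/-- The standing hypotheses on the submanifold. -/
structure Good (M : Set E) (T : E → Submodule ℝ E) (d : ℕ) (τ : ℝ) : Prop where
  cpt : IsCompact M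
  ne : M.Nonempty
  pos : 0 < τ
  uniq : UniqNear M τ
  rank : ∀ x ∈ M, Module.finrank ℝ (T x) = d
  lg : ∀ x ∈ M, ∃ (f : T x → (T x)ᗮ) (ε : ℝ), LG M x (T x) f ε

variable {M : Set E} {T : E → Submodule ℝ E} {d : ℕ} {τ : ℝ}

lemma Good.local_tan (g : Good M T d τ) {x : E} (hx : x ∈ M) {η : ℝ} (hη : 0 < η) :
    ∃ ρ > 0, ∀ x' ∈ M, dist x' x < ρ →
      (∀ v ∈ T x', ∃ a ∈ T x, ‖a‖ ≤ ‖v‖ ∧ ‖v - a‖ ≤ (1 / τ + η) * ‖x' - x‖ * ‖a‖) ∧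
      (∀ a ∈ T x, ∃ v ∈ T x', ‖v - a‖ ≤ (1 / τ + η) * ‖x' - x‖ * ‖a‖) := by
  obtain ⟨f, ε, h⟩ := g.lg x hx
  have hτ := g.pos
  obtain ⟨δ₁, hδ₁, h1⟩ := h.tangent g.cpt g.pos g.uniq
  obtain ⟨δ₂, hδ₂, h2⟩ := h.fderiv_bound g.cpt g.pos g.uniq hη
  refine ⟨min ε (min δ₁ δ₂), lt_min h.pos (lt_min hδ₁ hδ₂), fun x' hx' hd => ?_⟩
  obtain ⟨u, hu, hun⟩ := h.repr hx' (hd.trans_le (min_le_left _ _))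
  have hd' : ‖x' - x‖ < min δ₁ δ₂ := by
    rw [← dist_eq_norm]; exact hd.trans_le (min_le_right _ _)
  have hu1 : ‖u‖ < δ₁ := lt_of_le_of_lt hun (hd'.trans_le (min_le_left _ _))
  have hu2 : ‖u‖ < δ₂ := lt_of_le_of_lt hun (hd'.trans_le (min_le_right _ _))
  obtain ⟨f', ε', h'⟩ := g.lg x' hx'
  have hbd : ∀ a : T x, ‖(fderiv ℝ f u a : E)‖ ≤ (1 / τ + η) * ‖x' - x‖ * ‖(a : E)‖ := by
    intro a
    have e1 : ‖fderiv ℝ f u a‖ ≤ ‖fderiv ℝ f u‖ * ‖a‖ := ContinuousLinearMap.le_opNorm _ _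
    have e2 := h2 u hu2
    calc ‖(fderiv ℝ f u a : E)‖ = ‖fderiv ℝ f u a‖ := rfl
      _ ≤ ‖fderiv ℝ f u‖ * ‖a‖ := e1
      _ ≤ ((1 / τ + η) * ‖x' - x‖) * ‖a‖ := by
          gcongr
          exact e2.trans (by gcongr)
      _ = _ := rfl
  have hh := h1 u hu1 (T x') f' ε' (hu ▸ h') (by rw [g.rank x hx, g.rank x' hx'])
  constructor
  · intro v hv
    obtain ⟨a, ha⟩ := hh.2 v hv
    refine ⟨a, a.2, ?_, ?_⟩
    · rw [ha]; exact norm_le_split a _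
    · rw [ha, add_sub_cancel_left]; exact hbd a
  · intro a ha
    refine ⟨_, hh.1 ⟨a, ha⟩, ?_⟩
    rw [add_sub_cancel_left]; exact hbd _

/-- Angle between tangent spaces. -/
lemma Good.angle (g : Good M T d τ) {x y : E} (hx : x ∈ M) (hy : y ∈ M) (hxy : ‖x - y‖ / 2 < τ)
    {v : E} (hv : v ∈ T x) :
    ‖(T y)ᗮ.starProjection v‖ ≤ ‖x - y‖ / (1 - ‖x - y‖ / 2 / τ) / τ * ‖v‖ := by
  have hτ := g.pos
  set ℓ := ‖x - y‖ with hℓ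
  have hℓ0 : 0 ≤ ℓ := norm_nonneg _
  set Λ := ℓ / (1 - ℓ / 2 / τ) with hΛ
  have hden : 0 < 1 - ℓ / 2 / τ := by
    rw [sub_pos, div_lt_one hτ]; exact hxy
  have hΛ0 : 0 ≤ Λ := by positivity
  set z : ℝ → E := fun t => y + t • (x - y) with hz
  have hnear : ∀ t, ∃ m ∈ M, infDist (z t) M = dist (z t) m := fun t =>
    g.cpt.exists_infDist_eq_dist g.ne (z t)
  choose γ hγM hγd using hnear
  have hγ0 : γ 0 = y := by
    have h1 := hγd 0
    have h2 : z 0 = y := by simp [hz]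
    rw [h2, infDist_zero_of_mem hy] at h1
    exact (dist_eq_zero.mp h1.symm).symm
  have hγ1 : γ 1 = x := by
    have h1 := hγd 1
    have h2 : z 1 = x := by simp [hz]
    rw [h2, infDist_zero_of_mem hx] at h1
    exact (dist_eq_zero.mp h1.symm).symm
  have hinf : ∀ t ∈ Set.Icc (0:ℝ) 1, infDist (z t) M ≤ ℓ / 2 := by
    intro t ht
    by_cases h : t ≤ 1 / 2
    · refine (infDist_le_dist_of_mem hy).trans ?_
      rw [dist_eq_norm]
      simp only [hz, add_sub_cancel_left]
      rw [norm_smul, Real.norm_eq_abs, abs_of_nonneg ht.1, ← hℓ]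
      nlinarith
    · refine (infDist_le_dist_of_mem hx).trans ?_
      rw [dist_eq_norm]
      have : z t - x = (t - 1) • (x - y) := by simp only [hz]; module
      rw [this, norm_smul, Real.norm_eq_abs, abs_of_nonpos (by linarith [ht.2]), ← hℓ]
      nlinarith
  have hlip : ∀ t ∈ Set.Icc (0:ℝ) 1, ∀ t' ∈ Set.Icc (0:ℝ) 1, ‖γ t' - γ t‖ ≤ Λ * |t' - t| := by
    intro t ht t' ht'
    have h1 := proj_lip_s13 g.cpt g.ne g.uniq hxy g.pos (hγM t) (hinf t ht) (hγd t).symm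
      (hγM t') (hinf t' ht') (hγd t').symm
    have h2 : z t' - z t = (t' - t) • (x - y) := by simp only [hz]; module
    rw [h2, norm_smul, Real.norm_eq_abs, ← hℓ] at h1
    rw [hΛ, div_mul_eq_mul_div, le_div_iff₀ hden]
    linarith
  set Q := (T y)ᗮ.starProjection with hQ
  have hQn : ∀ w, ‖Q w‖ ≤ ‖w‖ := fun w => Submodule.norm_starProjection_apply_le _ w
  -- the estimate for every slack parameter
  have key : ∀ η > 0, ‖Q v‖ ≤ (1 / τ + η) * Λ * ‖v‖ := by
    intro η hη
    set c := 1 / τ + η with hc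
    have hc0 : 0 < c := by positivity
    set S : Set ℝ := {t | ∀ w ∈ T (γ t), ‖Q w‖ ≤ c * Λ * t * ‖w‖} with hS
    have hsub : Set.Icc (0:ℝ) 1 ⊆ S := by
      apply IsClosed.Icc_subset_of_forall_exists_gt
      · rw [← closure_subset_iff_isClosed]
        intro t ht
        have htI : t ∈ Set.Icc (0:ℝ) 1 :=
          closure_minimal Set.inter_subset_right isClosed_Icc ht
        refine ⟨?_, htI⟩
        intro w hw
        obtain ⟨ρ, hρ, hloc⟩ := g.local_tan (hγM t) hη
        have := mem_closure_iff_nhdsWithin_neBot.mp ht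
        have hcont : Continuous fun t' : ℝ =>
            c * Λ * t' * (1 + c * (Λ * |t' - t|)) * ‖w‖ + c * (Λ * |t' - t|) * ‖w‖ := by fun_prop
        have hlim := (hcont.tendsto t).mono_left (nhdsWithin_le_nhds (s := S ∩ Set.Icc 0 1))
        simp only [sub_self, abs_zero, mul_zero, add_zero, mul_one, zero_mul] at hlim
        refine ge_of_tendsto hlim ?_
        have hclose : ∀ᶠ t' in nhds t, Λ * |t' - t| < ρ := by
          have : Continuous fun t' : ℝ => Λ * |t' - t| := by fun_prop
          refine this.continuousAt.eventually_lt continuousAt_const ?_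
          simpa using hρ
        filter_upwards [self_mem_nhdsWithin, nhdsWithin_le_nhds hclose] with t' ht' hcl
        have hl := hlip t htI t' ht'.2
        obtain ⟨w', hw', hww⟩ := (hloc (γ t') (hγM t') (by
          rw [dist_eq_norm]; exact lt_of_le_of_lt hl hcl)).2 w hw
        have h1 := ht'.1 w' hw'
        have ht0 : 0 ≤ t' := ht'.2.1
        have h2 : ‖w' - w‖ ≤ c * (Λ * |t' - t|) * ‖w‖ := hww.trans (by gcongr)
        have h3 : ‖w'‖ ≤ (1 + c * (Λ * |t' - t|)) * ‖w‖ := by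
          have : w' = w + (w' - w) := by abel
          rw [this]
          refine (norm_add_le _ _).trans ?_
          linarith
        have h4 : Q w = Q w' - Q (w' - w) := by rw [map_sub]; abel
        rw [h4]
        refine (norm_sub_le _ _).trans (add_le_add ?_ ((hQn _).trans h2))
        refine h1.trans ?_
        rw [mul_assoc (c * Λ * t')]
        gcongr
      · intro w hw
        rw [hγ0] at hw
        have : Q w = 0 := by
          rw [hQ, Submodule.starProjection_apply_eq_zero_iff, Submodule.orthogonal_orthogonal]
          exact hw
        simp [this]
      · intro t ht t1 ht1
        have htI : t ∈ Set.Icc (0:ℝ) 1 := ⟨ht.2.1, ht.2.2.le⟩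
        obtain ⟨ρ, hρ, hloc⟩ := g.local_tan (hγM t) hη
        have hclose : ∀ᶠ t' in nhds t, Λ * |t' - t| < ρ := by
          have : Continuous fun t' : ℝ => Λ * |t' - t| := by fun_prop
          refine this.continuousAt.eventually_lt continuousAt_const ?_
          simpa using hρ
        have e1 : ∀ᶠ t' in nhdsWithin t (Set.Ioi t), t' ∈ Set.Ioc t (min t1 1) :=
          Ioc_mem_nhdsGT (lt_min ht1 ht.2.2)
        obtain ⟨t', ht', hcl⟩ := (e1.and (nhdsWithin_le_nhds hclose)).exists
        refine ⟨t', ?_, ht'.1, ht'.2.trans (min_le_left _ _)⟩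
        have ht'I : t' ∈ Set.Icc (0:ℝ) 1 :=
          ⟨ht.2.1.trans ht'.1.le, ht'.2.trans (min_le_right _ _)⟩
        have hl := hlip t htI t' ht'I
        intro w hw
        obtain ⟨a, ha, haw, hwa⟩ := (hloc (γ t') (hγM t') (by
          rw [dist_eq_norm]; exact lt_of_le_of_lt hl hcl)).1 w hw
        have h1 := ht.1 a ha
        have h2 : ‖w - a‖ ≤ c * (Λ * |t' - t|) * ‖a‖ := hwa.trans (by gcongr)
        rw [abs_of_pos (sub_pos.mpr ht'.1)] at h2
        have h4 : Q w = Q a + Q (w - a) := by rw [map_sub]; abel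
        have h5 := ht'I.1
        calc ‖Q w‖ ≤ ‖Q a‖ + ‖Q (w - a)‖ := by rw [h4]; exact norm_add_le _ _
          _ ≤ c * Λ * t * ‖a‖ + c * (Λ * (t' - t)) * ‖a‖ := add_le_add h1 ((hQn _).trans h2)
          _ = c * Λ * t' * ‖a‖ := by ring
          _ ≤ c * Λ * t' * ‖w‖ := by gcongr
    have := hsub (Set.right_mem_Icc.mpr zero_le_one) v (by rw [hγ1]; exact hv)
    rwa [mul_one] at this
  have hcont : Continuous fun η : ℝ => (1 / τ + η) * Λ * ‖v‖ := by fun_prop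
  have hlim := (hcont.tendsto 0).mono_left (nhdsWithin_le_nhds (s := Set.Ioi 0))
  have := ge_of_tendsto hlim (by filter_upwards [self_mem_nhdsWithin] with η hη using key η hη)
  calc _ ≤ _ := this
    _ = _ := by ring

/-- Chords of `M` near `y` are controlled by their projection to the tangent space at `y`. -/
lemma Good.chord (g : Good M T d τ) {y : E} (hy : y ∈ M) {s : ℝ} (hs : s ≤ τ / 8)
    {x x' : E} (hx : x ∈ M) (hxs : x ∈ Metric.ball y s) (hx' : x' ∈ M) (hxs' : x' ∈ Metric.ball y s) :
    ‖x - x'‖ ≤ Real.sqrt (1 + (2 * s / (τ - 2 * s)) ^ 2) * ‖(T y).starProjection (x - x')‖ := by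
  have hτ := g.pos
  have hd : ‖x - y‖ < s := by rw [← dist_eq_norm]; exact hxs
  have hd' : ‖x' - y‖ < s := by rw [← dist_eq_norm]; exact hxs'
  have hs0 : 0 < s := lt_of_le_of_lt (norm_nonneg _) hd
  set a := s / τ with ha
  have ha0 : 0 < a := by positivity
  have ha8 : a ≤ 1 / 8 := by rw [ha, div_le_iff₀ hτ]; linarith
  have hsa : s = a * τ := by rw [ha]; field_simp
  set w := x' - x with hw
  have hwn : ‖w‖ ≤ 2 * s := by
    have : w = (x' - y) - (x - y) := by rw [hw]; abel
    rw [this]; exact (norm_sub_le _ _).trans (by linarith)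
  set p := (T x).starProjection w with hp
  set q := (T x)ᗮ.starProjection w with hq
  have hpq : p + q = w := Submodule.starProjection_add_starProjection_orthogonal _
  have hpm : p ∈ T x := Submodule.starProjection_apply_mem _ _
  have hqm : q ∈ (T x)ᗮ := Submodule.starProjection_apply_mem _ _
  obtain ⟨f, ε, h⟩ := g.lg x hx
  have hqn : ‖q‖ ≤ a * ‖w‖ := by
    have h1 := h.ball_ineq g.cpt hτ g.uniq hqm hx'
    rw [← hw] at h1
    have h2 : ⟪q, w⟫ = ‖q‖ ^ 2 := by
      rw [← hpq, inner_add_right, Submodule.inner_left_of_mem_orthogonal hpm hqm, zero_add,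
        real_inner_self_eq_norm_sq]
    rw [h2] at h1
    rcases (norm_nonneg q).eq_or_lt with h0 | h0
    · rw [← h0]; positivity
    · have h3 : ‖q‖ * (2 * τ * ‖q‖) ≤ ‖q‖ * ‖w‖ ^ 2 := by linarith
      have h4 := le_of_mul_le_mul_left h3 h0
      have h5 : ‖w‖ ^ 2 ≤ 2 * s * ‖w‖ := by
        rw [sq]; gcongr
      rw [hsa] at h5
      have h6 : (2 * τ) * ‖q‖ ≤ (2 * τ) * (a * ‖w‖) := by linarith
      exact le_of_mul_le_mul_left h6 (by positivity)
  have hpn : ‖p‖ ≤ ‖w‖ := Submodule.norm_starProjection_apply_le _ w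
  set Q := (T y)ᗮ.starProjection with hQ
  have hQn : ∀ w, ‖Q w‖ ≤ ‖w‖ := fun w => Submodule.norm_starProjection_apply_le _ w
  have hQp : ‖Q p‖ ≤ a / (1 - a / 2) * ‖w‖ := by
    refine (g.angle hx hy (by linarith) hpm).trans ?_
    have e1 : ‖x - y‖ / (1 - ‖x - y‖ / 2 / τ) / τ ≤ a / (1 - a / 2) := by
      have e0 : ‖x - y‖ / τ ≤ a := by rw [ha]; gcongr
      have e2 : ‖x - y‖ / (1 - ‖x - y‖ / 2 / τ) / τ
        = (‖x - y‖ / τ) / (1 - (‖x - y‖ / τ) / 2) := by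
        rw [div_right_comm, div_right_comm ‖x - y‖ 2 τ]
      rw [e2]
      have e3 : 0 < 1 - a / 2 := by linarith
      gcongr
    have e4 : 0 < a / (1 - a / 2) := div_pos ha0 (by linarith)
    gcongr
  have hQw : ‖Q w‖ ≤ 2 * a / (1 - a / 2) * ‖w‖ := by
    have h1 : Q w = Q p + Q q := by rw [← map_add, hpq]
    have h2 : a ≤ a / (1 - a / 2) := by
      rw [le_div_iff₀ (by linarith)]; nlinarith
    calc ‖Q w‖ ≤ ‖Q p‖ + ‖Q q‖ := by rw [h1]; exact norm_add_le _ _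
      _ ≤ a / (1 - a / 2) * ‖w‖ + a / (1 - a / 2) * ‖w‖ := by
          refine add_le_add hQp ((hQn _).trans (hqn.trans ?_))
          gcongr
      _ = _ := by ring
  have hsq := Submodule.norm_sq_eq_add_norm_sq_starProjection w (T y)
  rw [← hQ] at hsq
  set P := (T y).starProjection with hP
  have hrev : x - x' = -w := by rw [hw]; abel
  rw [hrev, map_neg, norm_neg, norm_neg]
  refine le_of_sq_le_sq ?_ (by positivity)
  rw [mul_pow, Real.sq_sqrt (by positivity)]
  have hL : 2 * s / (τ - 2 * s) = 2 * a / (1 - 2 * a) := by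
    rw [hsa]
    have : 1 - 2 * a ≠ 0 := by intro h; linarith
    have : τ - 2 * (a * τ) ≠ 0 := by intro h; nlinarith
    field_simp
  rw [hL]
  have hQ2 : ‖Q w‖ ^ 2 ≤ (2 * a / (1 - a / 2)) ^ 2 * ‖w‖ ^ 2 := by
    rw [← mul_pow]; gcongr
  have hnum : 1 ≤ (1 + (2 * a / (1 - 2 * a)) ^ 2) * (1 - (2 * a / (1 - a / 2)) ^ 2) := by
    have p1 : 0 < 1 - 2 * a := by linarith
    have p2 : 0 < 1 - a / 2 := by linarith
    rw [div_pow, div_pow, one_add_div (by positivity), one_sub_div (by positivity),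
      div_mul_div_comm, le_div_iff₀ (by positivity), one_mul]
    have : (1 - 2 * a) ^ 2 + (2 * a) ^ 2 ≤ (1 - a / 2) ^ 2 := by nlinarith
    nlinarith [sq_nonneg a]
  have hPw : (1 - (2 * a / (1 - a / 2)) ^ 2) * ‖w‖ ^ 2 ≤ ‖P w‖ ^ 2 := by linarith
  calc ‖w‖ ^ 2 = 1 * ‖w‖ ^ 2 := by ring
    _ ≤ (1 + (2 * a / (1 - 2 * a)) ^ 2) * (1 - (2 * a / (1 - a / 2)) ^ 2) * ‖w‖ ^ 2 := by gcongr
    _ = (1 + (2 * a / (1 - 2 * a)) ^ 2) * ((1 - (2 * a / (1 - a / 2)) ^ 2) * ‖w‖ ^ 2) := by ring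
    _ ≤ _ := by gcongr

end Angle

section TubeLocal

variable {E : Type*} [NormedAddCommGroup E] [InnerProductSpace ℝ E] [FiniteDimensional ℝ E]

/-- The real adjoint as a continuous linear map. -/
def adjL (F G : Type*) [NormedAddCommGroup F] [InnerProductSpace ℝ F] [CompleteSpace F]
    [NormedAddCommGroup G] [InnerProductSpace ℝ G] [CompleteSpace G] :
    (F →L[ℝ] G) →L[ℝ] (G →L[ℝ] F) :=
  LinearMap.mkContinuous
    { toFun := fun A => ContinuousLinearMap.adjoint A
      map_add' := fun A B => map_add _ A B
      map_smul' := fun c A => by simp } 1 (fun A => by simp)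

lemma adjL_apply {F G : Type*} [NormedAddCommGroup F] [InnerProductSpace ℝ F] [CompleteSpace F]
    [NormedAddCommGroup G] [InnerProductSpace ℝ G] [CompleteSpace G] (A : F →L[ℝ] G) :
    adjL F G A = ContinuousLinearMap.adjoint A := rfl

lemma adjL_norm {F G : Type*} [NormedAddCommGroup F] [InnerProductSpace ℝ F] [CompleteSpace F]
    [NormedAddCommGroup G] [InnerProductSpace ℝ G] [CompleteSpace G] (A : F →L[ℝ] G) :
    ‖adjL F G A‖ = ‖A‖ := by
  rw [adjL_apply]; simp

/-- Volume of a product set with respect to an orthogonal splitting. -/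
lemma vol_split [MeasurableSpace E] [BorelSpace E] (T : Submodule ℝ E) (U : Set T) (V : Set Tᗮ) :
    volume {z : E | T.orthogonalProjectionOnto z ∈ U ∧ Tᗮ.orthogonalProjectionOnto z ∈ V}
      = volume U * volume V := by
  have h := T.measurePreserving_measurableEquivProd (0 : E)
  rw [InnerProductSpace.euclideanHausdorffMeasure_eq_volume] at h
  have h1 := h.measure_preimage_equiv (U ×ˢ V)
  rw [Measure.volume_eq_prod, Measure.prod_prod] at h1
  rw [← h1]
  congr 1
  ext z
  simp

/-- The normal parametrization over a graph. -/
def tubeMap (x : E) (T : Submodule ℝ E) (f : T → Tᗮ) (z : E) : E :=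
  x + (T.orthogonalProjectionOnto z : E)
    - (adjL T Tᗮ (fderiv ℝ f (T.orthogonalProjectionOnto z)) (Tᗮ.orthogonalProjectionOnto z) : E)
    + (f (T.orthogonalProjectionOnto z) : E) + (Tᗮ.orthogonalProjectionOnto z : E)

variable {M : Set E} {x : E} {T : Submodule ℝ E} {f : T → Tᗮ} {ε : ℝ}

lemma LG.tubeMap_contDiff (h : LG M x T f ε) : ContDiff ℝ 1 (tubeMap x T f) := by
  have h1 : ContDiff ℝ 1 fun z : E => fderiv ℝ f (T.orthogonalProjectionOnto z) :=
    h.dcd.comp (T.orthogonalProjectionOnto).contDiff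
  have h2 : ContDiff ℝ 1 fun z : E => adjL T Tᗮ (fderiv ℝ f (T.orthogonalProjectionOnto z)) :=
    (adjL T Tᗮ).contDiff.comp h1
  have h3 : ContDiff ℝ 1 fun z : E =>
      adjL T Tᗮ (fderiv ℝ f (T.orthogonalProjectionOnto z)) (Tᗮ.orthogonalProjectionOnto z) :=
    h2.clm_apply (Tᗮ.orthogonalProjectionOnto).contDiff
  have h4 : ContDiff ℝ 1 fun z : E => f (T.orthogonalProjectionOnto z) :=
    (h.cd.of_le (by norm_num)).comp (T.orthogonalProjectionOnto).contDiff
  have h5 := T.subtypeL.contDiff (n := 1) |>.comp h3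
  have h6 := Tᗮ.subtypeL.contDiff (n := 1) |>.comp h4
  have h7 := T.subtypeL.contDiff (n := 1) |>.comp (T.orthogonalProjectionOnto).contDiff
  have h8 := Tᗮ.subtypeL.contDiff (n := 1) |>.comp (Tᗮ.orthogonalProjectionOnto).contDiff
  exact (((contDiff_const.add h7).sub h5).add h6).add h8

lemma split_add (T : Submodule ℝ E) (z : E) :
    (T.orthogonalProjectionOnto z : E) + (Tᗮ.orthogonalProjectionOnto z : E) = z :=
  Submodule.starProjection_add_starProjection_orthogonal z

lemma LG.tubeMap_fderiv (h : LG M x T f ε) {z : E} (hz : T.orthogonalProjectionOnto z = 0) (ζ : E) :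
    fderiv ℝ (tubeMap x T f) z ζ = ζ -
      (adjL T Tᗮ (fderiv ℝ (fderiv ℝ f) 0 (T.orthogonalProjectionOnto ζ))
        (Tᗮ.orthogonalProjectionOnto z) : E) := by
  have hP := (T.orthogonalProjectionOnto).hasFDerivAt (x := z)
  have hQ := (Tᗮ.orthogonalProjectionOnto).hasFDerivAt (x := z)
  have b0 : HasFDerivAt (fderiv ℝ f) (fderiv ℝ (fderiv ℝ f) 0) (T.orthogonalProjectionOnto z) := by
    rw [hz]
    exact ((h.dcd.differentiable (by norm_num)) 0).hasFDerivAt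
  have b1 : HasFDerivAt f (fderiv ℝ f 0) (T.orthogonalProjectionOnto z) := by
    rw [hz]
    exact (h.diff 0).hasFDerivAt
  have h1 := HasFDerivAt.comp (𝕜 := ℝ) (E := E) (F := T) (G := T →L[ℝ] Tᗮ) z b0 hP
  have h2 := HasFDerivAt.comp (𝕜 := ℝ) (E := E) (F := T →L[ℝ] Tᗮ) (G := Tᗮ →L[ℝ] T) z
    (adjL T Tᗮ).hasFDerivAt h1
  have h3 := h2.clm_apply hQ
  have h4 := b1.comp z hP
  have h5 := T.subtypeL.hasFDerivAt.comp z h3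
  have h6 := Tᗮ.subtypeL.hasFDerivAt.comp z h4
  have h7 := T.subtypeL.hasFDerivAt.comp z hP
  have h8 := Tᗮ.subtypeL.hasFDerivAt.comp z hQ
  have h9 := ((((hasFDerivAt_const x z).add h7).sub h5).add h6).add h8
  have h10 : fderiv ℝ (tubeMap x T f) z = _ := HasFDerivAt.fderiv h9
  rw [h10]
  have hs := split_add T ζ
  simp [hz, h.df0]

/-- The determinant bound over the base point. -/
lemma LG.det_bound (h : LG M x T f ε) (hM : IsCompact M) {τ : ℝ} (hτ : 0 < τ) (hU : UniqNear M τ)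
    {z : E} (hz : T.orthogonalProjectionOnto z = 0) :
    |(fderiv ℝ (tubeMap x T f) z).det| ≤
      (1 + ‖Tᗮ.orthogonalProjectionOnto z‖ / τ) ^ (Module.finrank ℝ T) := by
  let _ : MeasurableSpace E := borel E
  have _ : BorelSpace E := ⟨rfl⟩
  set w := Tᗮ.orthogonalProjectionOnto z with hw
  set κ := ‖w‖ / τ with hκ
  have hκ0 : 0 ≤ κ := by positivity
  set L := fderiv ℝ (tubeMap x T f) z with hL
  set B : Set E := {ζ : E | T.orthogonalProjectionOnto ζ ∈ ball (0 : T) 1 ∧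
    Tᗮ.orthogonalProjectionOnto ζ ∈ ball (0 : Tᗮ) 1} with hB
  set B' : Set E := {ζ : E | T.orthogonalProjectionOnto ζ ∈ ball (0 : T) (1 + κ) ∧
    Tᗮ.orthogonalProjectionOnto ζ ∈ ball (0 : Tᗮ) 1} with hB'
  have himg : L '' B ⊆ B' := by
    rintro _ ⟨ζ, hζ, rfl⟩
    have hLζ := h.tubeMap_fderiv hz ζ
    rw [← hL, ← hw] at hLζ
    set u := T.orthogonalProjectionOnto ζ with hu
    set b : T := adjL T Tᗮ (fderiv ℝ (fderiv ℝ f) 0 u) w with hb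
    have hbn : ‖b‖ ≤ κ * ‖u‖ := by
      have h4 : ‖fderiv ℝ (fderiv ℝ f) 0 u‖ ≤ 1 / τ * ‖u‖ := by
        refine ContinuousLinearMap.opNorm_le_bound _ (by positivity) fun v => ?_
        calc _ ≤ _ := h.snd_bound hM hτ hU u v
          _ = _ := by ring
      calc ‖b‖ ≤ ‖adjL T Tᗮ (fderiv ℝ (fderiv ℝ f) 0 u)‖ * ‖w‖ := ContinuousLinearMap.le_opNorm _ _
        _ ≤ (1 / τ * ‖u‖) * ‖w‖ := by rw [adjL_norm]; gcongr
        _ = _ := by rw [hκ]; ring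
    have hu1 : ‖u‖ < 1 := mem_ball_zero_iff.mp hζ.1
    have e1 : T.orthogonalProjectionOnto (L ζ) = u - b := by
      rw [hLζ, map_sub, Submodule.orthogonalProjectionOnto_mem_subspace_eq_self]
    have e2 : Tᗮ.orthogonalProjectionOnto (L ζ) = Tᗮ.orthogonalProjectionOnto ζ := by
      rw [hLζ, map_sub, Submodule.orthogonalProjectionOnto_orthogonal_apply_eq_zero b.2, sub_zero]
    refine ⟨?_, ?_⟩
    · rw [e1, mem_ball_zero_iff]
      refine lt_of_le_of_lt (norm_sub_le _ _) ?_
      nlinarith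
    · rw [e2]; exact hζ.2
  have hvol := measure_mono (μ := volume) himg
  rw [Measure.addHaar_image_continuousLinearMap, hB, hB', vol_split, vol_split,
    Measure.addHaar_ball_of_pos volume (0 : T) (by positivity : 0 < 1 + κ), mul_assoc] at hvol
  have hpos : volume (ball (0 : T) 1) * volume (ball (0 : Tᗮ) 1) ≠ 0 :=
    mul_ne_zero (measure_ball_pos volume _ one_pos).ne' (measure_ball_pos volume _ one_pos).ne'
  have hfin : volume (ball (0 : T) 1) * volume (ball (0 : Tᗮ) 1) ≠ ∞ :=
    ENNReal.mul_ne_top measure_ball_lt_top.ne measure_ball_lt_top.ne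
  have h2 := (ENNReal.mul_le_mul_iff_left hpos hfin).mp hvol
  exact (ENNReal.ofReal_le_ofReal_iff (by positivity)).mp h2

/-- Local tube volume estimate. -/
lemma Good.tube_local [MeasurableSpace E] [BorelSpace E] {T : E → Submodule ℝ E} {d : ℕ} {τ : ℝ}
    (g : Good M T d τ) (hx : x ∈ M) {σ : ℝ} {c : ℝ} (hc : (1 + σ / τ) ^ d < c) :
    ∃ ρ > 0, ∀ A ⊆ M ∩ ball x ρ, MeasurableSet A →
      volume {z : E | infDist z M < σ ∧ ∃ m ∈ A, dist z m = infDist z M} ≤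
        ENNReal.ofReal c * (volume ((fun m => (T x).orthogonalProjectionOnto (m - x)) '' A) *
          volume (ball (0 : (T x)ᗮ) σ)) := by
  have hτ := g.pos
  obtain ⟨f, ε, h⟩ := g.lg x hx
  set P := (T x).orthogonalProjectionOnto with hP
  set Q := (T x)ᗮ.orthogonalProjectionOnto with hQ
  obtain ⟨δ₁, hδ₁, h1⟩ := h.tangent g.cpt g.pos g.uniq
  have hcd := h.tubeMap_contDiff
  set Φ := tubeMap x (T x) f with hΦ
  have hJc : Continuous fun z => |(fderiv ℝ Φ z).det| :=
    (ContinuousLinearMap.continuous_det.comp (hcd.continuous_fderiv (by norm_num))).abs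
  set K : Set E := {z | P z = 0 ∧ ‖Q z‖ ≤ σ} with hK
  have hKc : IsCompact K := by
    refine Metric.isCompact_of_isClosed_isBounded ?_ ?_
    · exact (isClosed_eq P.continuous continuous_const).inter
        (isClosed_le Q.continuous.norm continuous_const)
    · refine (Metric.isBounded_closedBall (x := (0:E)) (r := σ)).subset ?_
      rintro z ⟨hz1, hz2⟩
      have := split_add (T x) z
      rw [← hP, ← hQ, hz1] at this
      rw [mem_closedBall_zero_iff, ← this]
      simpa using hz2
  have hKsub : K ⊆ {z | |(fderiv ℝ Φ z).det| < c} := by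
    rintro z ⟨hz1, hz2⟩
    refine lt_of_le_of_lt (h.det_bound g.cpt hτ g.uniq hz1) (lt_of_le_of_lt ?_ hc)
    rw [g.rank x hx]
    gcongr
  obtain ⟨ρ', hρ', hthick⟩ := hKc.exists_thickening_subset_open
    (isOpen_lt hJc continuous_const) hKsub
  refine ⟨min ε (min δ₁ ρ'), lt_min h.pos (lt_min hδ₁ hρ'), fun A hA hAm => ?_⟩
  set U : Set (T x) := {u | ‖u‖ < ρ' ∧ x + (u : E) + (f u : E) ∈ A} with hUdef
  have hUm : MeasurableSet U := by
    have hc1 : Continuous fun u : T x => x + (u : E) + (f u : E) := by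
      have := h.diff.continuous; fun_prop
    exact (isOpen_lt continuous_norm continuous_const).measurableSet.inter (hc1.measurable hAm)
  set S : Set E := {z | P z ∈ U ∧ Q z ∈ ball (0 : (T x)ᗮ) σ} with hS
  have hSm : MeasurableSet S :=
    (P.continuous.measurable hUm).inter (Q.continuous.measurable measurableSet_ball)
  have hsub : {z : E | infDist z M < σ ∧ ∃ m ∈ A, dist z m = infDist z M} ⊆ Φ '' S := by
    rintro z ⟨hz, m, hm, hzm⟩
    have hmM := (hA hm).1
    have hmd : dist m x < min ε (min δ₁ ρ') := (hA hm).2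
    obtain ⟨u, hu, hun⟩ := h.repr hmM (hmd.trans_le (min_le_left _ _))
    have hd' : ‖m - x‖ < min δ₁ ρ' := by
      rw [← dist_eq_norm]; exact hmd.trans_le (min_le_right _ _)
    have hu1 : ‖u‖ < δ₁ := lt_of_le_of_lt hun (hd'.trans_le (min_le_left _ _))
    have hu2 : ‖u‖ < ρ' := lt_of_le_of_lt hun (hd'.trans_le (min_le_right _ _))
    obtain ⟨f', ε', h'⟩ := g.lg m hmM
    have hh := (h1 u hu1 (T m) f' ε' (hu ▸ h') (by rw [g.rank x hx, g.rank m hmM])).1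
    have horth := h'.orth hzm
    set n := z - m with hn
    have hsplit := split_add (T x) n
    rw [← hP, ← hQ] at hsplit
    have hPn : P n = -(adjL (T x) (T x)ᗮ (fderiv ℝ f u) (Q n)) := by
      refine ext_inner_right ℝ fun a => ?_
      have e1 : ⟪n, (a : E) + (fderiv ℝ f u a : E)⟫ = 0 :=
        Submodule.inner_left_of_mem_orthogonal (hh a) horth
      rw [← hsplit, inner_add_left, inner_add_right, inner_add_right,
        Submodule.inner_right_of_mem_orthogonal (P n).2 (fderiv ℝ f u a).2,
        Submodule.inner_left_of_mem_orthogonal a.2 (Q n).2] at e1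
      have e2 : ⟪P n, a⟫ + ⟪Q n, fderiv ℝ f u a⟫ = 0 := by
        simpa using e1
      rw [inner_neg_left, adjL_apply, ContinuousLinearMap.adjoint_inner_left]
      linarith
    have hP0 : P ((u : E) + (Q n : E)) = u := by
      rw [map_add, hP, Submodule.orthogonalProjectionOnto_mem_subspace_eq_self,
        Submodule.orthogonalProjectionOnto_eq_zero_iff.mpr (Q n).2, add_zero]
    have hQ0 : Q ((u : E) + (Q n : E)) = Q n := by
      rw [map_add]
      have e3 : Q (u : E) = 0 := Submodule.orthogonalProjectionOnto_orthogonal_apply_eq_zero u.2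
      have e4 : Q (Q n : E) = Q n := Submodule.orthogonalProjectionOnto_mem_subspace_eq_self _
      rw [e3, e4, zero_add]
    refine ⟨(u : E) + (Q n : E), ⟨?_, ?_⟩, ?_⟩
    · rw [hP0]; exact ⟨hu2, hu ▸ hm⟩
    · rw [hQ0, mem_ball_zero_iff]
      have : ‖Q n‖ ≤ ‖n‖ := Submodule.norm_orthogonalProjectionOnto_apply_le _ n
      refine lt_of_le_of_lt this ?_
      rw [hn, ← dist_eq_norm, hzm]; exact hz
    · have e5 : Φ ((u : E) + (Q n : E)) = x + (u : E)
          - (adjL (T x) (T x)ᗮ (fderiv ℝ f u) (Q n) : E) + (f u : E) + (Q n : E) := by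
        rw [hΦ, tubeMap, ← hP, ← hQ, hP0, hQ0]
      rw [e5]
      have e6 : z = m + ((P n : E) + (Q n : E)) := by rw [hsplit, hn]; abel
      rw [e6, hu, hPn]
      push_cast
      abel
  have hJ : ∀ z ∈ S, ENNReal.ofReal |(fderiv ℝ Φ z).det| ≤ ENNReal.ofReal c := by
    rintro z ⟨hz1, hz2⟩
    have hmem : z ∈ thickening ρ' K := by
      rw [mem_thickening_iff]
      have e3 : P (Q z : E) = 0 := Submodule.orthogonalProjectionOnto_eq_zero_iff.mpr (Q z).2
      have e4 : Q (Q z : E) = Q z := Submodule.orthogonalProjectionOnto_mem_subspace_eq_self _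
      refine ⟨(Q z : E), ⟨e3, ?_⟩, ?_⟩
      · rw [e4]; exact (mem_ball_zero_iff.mp hz2).le
      · have := split_add (T x) z
        rw [← hP, ← hQ] at this
        rw [dist_eq_norm]
        nth_rewrite 1 [← this]
        rw [add_sub_cancel_right]
        exact hz1.1
    exact ENNReal.ofReal_le_ofReal (hthick hmem).le
  have hUsub : U ⊆ (fun m => P (m - x)) '' A := by
    rintro u ⟨hu1, hu2⟩
    refine ⟨_, hu2, ?_⟩
    have e0 : x + (u : E) + (f u : E) - x = (u : E) + (f u : E) := by abel
    change P (x + (u : E) + (f u : E) - x) = u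
    rw [e0, map_add, hP, Submodule.orthogonalProjectionOnto_mem_subspace_eq_self,
      Submodule.orthogonalProjectionOnto_eq_zero_iff.mpr (f u).2, add_zero]
  calc _ ≤ volume (Φ '' S) := measure_mono hsub
    _ ≤ ∫⁻ z in S, ENNReal.ofReal |(fderiv ℝ Φ z).det| :=
        addHaar_image_le_lintegral_abs_det_fderiv volume hSm fun z _ =>
          ((hcd.differentiable (by norm_num)) z).hasFDerivAt.hasFDerivWithinAt
    _ ≤ ∫⁻ z in S, ENNReal.ofReal c := setLIntegral_mono' hSm hJ
    _ = ENNReal.ofReal c * volume S := setLIntegral_const _ _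
    _ = ENNReal.ofReal c * (volume U * volume (ball (0 : (T x)ᗮ) σ)) := by rw [hS, vol_split]
    _ ≤ _ := by gcongr

end TubeLocal

section Assembly

lemma he_image_le {X Y : Type*} [MetricSpace X] [MeasurableSpace X] [BorelSpace X]
    [MetricSpace Y] [MeasurableSpace Y] [BorelSpace Y] {K : NNReal} {g : X → Y} {A : Set X}
    (h : LipschitzOnWith K g A) (d : ℕ) :
    (μHE[d] : Measure Y) (g '' A) ≤ (K : ℝ≥0∞) ^ d * (μHE[d] : Measure X) A := by
  rw [Measure.euclideanHausdorffMeasure_def, Measure.euclideanHausdorffMeasure_def,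
    Measure.smul_apply, Measure.smul_apply, ENNReal.smul_def, ENNReal.smul_def, smul_eq_mul,
    smul_eq_mul]
  have := h.hausdorffMeasure_image_le (d := (d : ℝ)) (by positivity)
  rw [ENNReal.rpow_natCast] at this
  calc _ ≤ _ := mul_le_mul_right this _
    _ = _ := by ring

lemma vol_ball_eq {V : Type*} [NormedAddCommGroup V] [InnerProductSpace ℝ V]
    [FiniteDimensional ℝ V] [MeasurableSpace V] [BorelSpace V] {k : ℕ}
    (h : Module.finrank ℝ V = k) (ρ : ℝ) :
    volume (ball (0 : V) ρ) = volume (ball (0 : EuclideanSpace ℝ (Fin k)) ρ) := by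
  subst h
  have hm := (stdOrthonormalBasis ℝ V).measurePreserving_repr
  rw [← hm.measure_preimage measurableSet_ball.nullMeasurableSet]
  congr 1
  ext v
  simp

variable {E : Type*} [NormedAddCommGroup E] [InnerProductSpace ℝ E] [FiniteDimensional ℝ E]
  [MeasurableSpace E] [BorelSpace E]
variable {M : Set E} {T : E → Submodule ℝ E} {d : ℕ} {τ : ℝ}

/-- Points of the tube whose nearest point lies in `A`. -/
def tubeOver (M : Set E) (σ : ℝ) (A : Set E) : Set E :=
  {z : E | infDist z M < σ ∧ ∃ m ∈ A, dist z m = infDist z M}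

lemma Good.tube_global (g : Good M T d τ) {σ : ℝ} {c : ℝ} (hc : (1 + σ / τ) ^ d < c)
    {A : Set E} (hA : A ⊆ M) (hAm : MeasurableSet A) :
    volume (tubeOver M σ A) ≤ ENNReal.ofReal c * ((μHE[d] : Measure E) A *
      volume (ball (0 : EuclideanSpace ℝ (Fin (Module.finrank ℝ E - d))) σ)) := by
  set vσ := volume (ball (0 : EuclideanSpace ℝ (Fin (Module.finrank ℝ E - d))) σ) with hvσ
  have hloc : ∀ x : M, ∃ ρ > 0, ∀ A ⊆ M ∩ ball (x : E) ρ, MeasurableSet A →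
      volume (tubeOver M σ A) ≤ ENNReal.ofReal c * ((μHE[d] : Measure E) A * vσ) := by
    rintro ⟨x, hx⟩
    obtain ⟨ρ, hρ, h⟩ := g.tube_local hx hc
    refine ⟨ρ, hρ, fun A hA hAm => (h A hA hAm).trans ?_⟩
    have hr := g.rank x hx
    have hr' : Module.finrank ℝ (T x)ᗮ = Module.finrank ℝ E - d := by
      have := (T x).finrank_add_finrank_orthogonal
      omega
    rw [vol_ball_eq hr']
    have hlip : LipschitzOnWith 1 (fun m => (T x).orthogonalProjectionOnto (m - x)) A := by
      refine LipschitzOnWith.of_dist_le_mul fun a _ b _ => ?_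
      rw [dist_eq_norm, dist_eq_norm, ← map_sub]
      have : a - x - (b - x) = a - b := by abel
      rw [this, NNReal.coe_one, one_mul]
      exact Submodule.norm_orthogonalProjectionOnto_apply_le _ _
    have h1 := he_image_le hlip d
    rw [ENNReal.coe_one, one_pow, one_mul] at h1
    have h2 := InnerProductSpace.euclideanHausdorffMeasure_eq_volume (V := T x)
    rw [hr] at h2
    rw [h2] at h1
    gcongr
  choose ρ hρ hbound using hloc
  have hfin : ∀ t : Finset M, ∀ A ⊆ M, A ⊆ ⋃ x ∈ t, ball (x : E) (ρ x) → MeasurableSet A →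
      volume (tubeOver M σ A) ≤ ENNReal.ofReal c * ((μHE[d] : Measure E) A * vσ) := by
    intro t
    induction t using Finset.induction_on with
    | empty =>
      intro A _ hA _
      have : A = ∅ := by simpa [Set.subset_empty_iff] using hA
      simp [this, tubeOver]
    | insert x t hxt ih =>
      intro A hAM hA hAm
      have hsub : tubeOver M σ A ⊆
          tubeOver M σ (A ∩ ball (x : E) (ρ x)) ∪ tubeOver M σ (A \ ball (x : E) (ρ x)) := by
        rintro z ⟨hz, m, hm, hzm⟩
        by_cases hmb : m ∈ ball (x : E) (ρ x)
        · exact Or.inl ⟨hz, m, ⟨hm, hmb⟩, hzm⟩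
        · exact Or.inr ⟨hz, m, ⟨hm, hmb⟩, hzm⟩
      have h1 := hbound x (A ∩ ball (x : E) (ρ x)) (Set.inter_subset_inter_left _ hAM)
        (hAm.inter measurableSet_ball)
      have h2 := ih (A \ ball (x : E) (ρ x)) (Set.diff_subset.trans hAM) (by
        rintro m ⟨hm, hmb⟩
        have := hA hm
        simp only [Finset.set_biUnion_insert] at this
        exact this.resolve_left hmb) (hAm.diff measurableSet_ball)
      calc _ ≤ _ := measure_mono hsub
        _ ≤ _ := measure_union_le _ _
        _ ≤ _ := add_le_add h1 h2
        _ = ENNReal.ofReal c * (((μHE[d] : Measure E) (A ∩ ball (x : E) (ρ x)) +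
            (μHE[d] : Measure E) (A \ ball (x : E) (ρ x))) * vσ) := by ring
        _ = _ := by rw [measure_inter_add_diff _ measurableSet_ball]
  obtain ⟨t, ht⟩ := g.cpt.elim_finite_subcover (fun x : M => ball (x : E) (ρ x))
    (fun _ => isOpen_ball) (fun m hm => Set.mem_iUnion.mpr ⟨⟨m, hm⟩, mem_ball_self (hρ _)⟩)
  exact hfin t A hA (hA.trans ht) hAm

lemma Good.he_bound (g : Good M T d τ) {y : E} (hy : y ∈ M) {s : ℝ} (hs : s ≤ τ / 8) :
    (μHE[d] : Measure E) (M ∩ ball y s) ≤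
      ENNReal.ofReal ((1 + (2 * s / (τ - 2 * s)) ^ 2) ^ ((d : ℝ) / 2)) *
        volume (ball (0 : EuclideanSpace ℝ (Fin d)) s) := by
  set C := Real.sqrt (1 + (2 * s / (τ - 2 * s)) ^ 2) with hC
  set A := M ∩ ball y s with hA
  set p : E → T y := fun m => (T y).orthogonalProjectionOnto (m - y) with hp
  have hchord : ∀ a ∈ A, ∀ b ∈ A, dist a b ≤ C * dist (p a) (p b) := by
    intro a ha b hb
    have h1 := g.chord hy hs ha.1 ha.2 hb.1 hb.2
    have h2 : p a - p b = (T y).orthogonalProjectionOnto (a - b) := by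
      simp only [hp]; rw [← map_sub]; congr 1; abel
    rw [dist_eq_norm, dist_eq_norm, h2]
    exact h1
  by_cases hne : A.Nonempty
  swap
  · rw [Set.not_nonempty_iff_eq_empty.mp hne]; simp
  have : Nonempty E := ⟨y⟩
  set q := Function.invFunOn p A with hq
  have hq1 : ∀ a ∈ A, q (p a) ∈ A ∧ p (q (p a)) = p a := fun a ha =>
    ⟨Function.invFunOn_mem ⟨a, ha, rfl⟩, Function.invFunOn_eq ⟨a, ha, rfl⟩⟩
  have hlip : LipschitzOnWith C.toNNReal q (p '' A) := by
    refine LipschitzOnWith.of_dist_le_mul ?_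
    rintro _ ⟨a, ha, rfl⟩ _ ⟨b, hb, rfl⟩
    have h1 := hchord _ (hq1 a ha).1 _ (hq1 b hb).1
    rw [(hq1 a ha).2, (hq1 b hb).2] at h1
    rwa [Real.coe_toNNReal _ (Real.sqrt_nonneg _)]
  have himg : A ⊆ q '' (p '' A) := by
    intro a ha
    refine ⟨p a, ⟨a, ha, rfl⟩, ?_⟩
    have h1 := hchord _ (hq1 a ha).1 a ha
    rw [(hq1 a ha).2, dist_self, mul_zero] at h1
    exact dist_le_zero.mp h1
  have hball : p '' A ⊆ ball (0 : T y) s := by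
    rintro _ ⟨a, ha, rfl⟩
    rw [mem_ball_zero_iff]
    refine lt_of_le_of_lt (Submodule.norm_orthogonalProjectionOnto_apply_le _ _) ?_
    rw [← dist_eq_norm]; exact ha.2
  have hr := g.rank y hy
  have h2 := InnerProductSpace.euclideanHausdorffMeasure_eq_volume (V := T y)
  rw [hr] at h2
  have hCd : ((C.toNNReal : NNReal) : ℝ≥0∞) ^ d
      = ENNReal.ofReal ((1 + (2 * s / (τ - 2 * s)) ^ 2) ^ ((d : ℝ) / 2)) := by
    rw [← ENNReal.ofReal, ← ENNReal.ofReal_pow (Real.sqrt_nonneg _), Real.sqrt_eq_rpow,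
      ← Real.rpow_natCast, ← Real.rpow_mul (by positivity)]
    congr 2; ring
  calc (μHE[d] : Measure E) A ≤ (μHE[d] : Measure E) (q '' (p '' A)) := measure_mono himg
    _ ≤ (C.toNNReal : ℝ≥0∞) ^ d * (μHE[d] : Measure (T y)) (p '' A) := he_image_le hlip d
    _ ≤ (C.toNNReal : ℝ≥0∞) ^ d * volume (ball (0 : T y) s) := by
        rw [h2]; gcongr
    _ = _ := by rw [hCd, vol_ball_eq hr]

lemma Good.tube_ball (g : Good M T d τ) {y : E} (hy : y ∈ M) {r σ : ℝ} (hσ : 0 < σ)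
    (hr : r + σ ≤ τ / 8) :
    volume ({z | infDist z M < σ} ∩ ball y r) ≤
      ENNReal.ofReal ((1 + σ / τ) ^ d *
          (1 + (2 * (r + σ) / (τ - 2 * (r + σ))) ^ 2) ^ ((d : ℝ) / 2)) *
        volume (ball (0 : EuclideanSpace ℝ (Fin d)) (r + σ)) *
        volume (ball (0 : EuclideanSpace ℝ (Fin (Module.finrank ℝ E - d))) σ) := by
  have hτ := g.pos
  have hsub : {z | infDist z M < σ} ∩ ball y r ⊆ tubeOver M σ (M ∩ ball y (r + σ)) := by
    rintro z ⟨hz, hzy⟩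
    obtain ⟨m, hm, hd⟩ := g.cpt.exists_infDist_eq_dist g.ne z
    refine ⟨hz, m, ⟨hm, ?_⟩, hd.symm⟩
    have h1 : dist m y ≤ dist m z + dist z y := dist_triangle _ _ _
    have h2 : dist z y < r := hzy
    have h3 : dist m z < σ := by rw [dist_comm, ← hd]; exact hz
    rw [mem_ball]; linarith
  have hAm : MeasurableSet (M ∩ ball y (r + σ)) := g.cpt.measurableSet.inter measurableSet_ball
  have hb := g.he_bound hy hr
  set K := ENNReal.ofReal ((1 + (2 * (r + σ) / (τ - 2 * (r + σ))) ^ 2) ^ ((d : ℝ) / 2)) *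
        volume (ball (0 : EuclideanSpace ℝ (Fin d)) (r + σ)) *
        volume (ball (0 : EuclideanSpace ℝ (Fin (Module.finrank ℝ E - d))) σ) with hK
  have hKfin : K ≠ ∞ := ENNReal.mul_ne_top
    (ENNReal.mul_ne_top ENNReal.ofReal_ne_top measure_ball_lt_top.ne) measure_ball_lt_top.ne
  have key : ∀ c > (1 + σ / τ) ^ d,
      volume ({z | infDist z M < σ} ∩ ball y r) ≤ ENNReal.ofReal c * K := by
    intro c hc
    calc _ ≤ _ := measure_mono hsub
      _ ≤ _ := g.tube_global hc Set.inter_subset_left hAm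
      _ ≤ _ := by rw [hK]; gcongr
  have hlim : Filter.Tendsto (fun c : ℝ => ENNReal.ofReal c * K)
      (nhdsWithin ((1 + σ / τ) ^ d) (Set.Ioi ((1 + σ / τ) ^ d)))
      (nhds (ENNReal.ofReal ((1 + σ / τ) ^ d) * K)) :=
    ENNReal.Tendsto.mul_const
      ((ENNReal.continuous_ofReal.tendsto _).mono_left nhdsWithin_le_nhds) (Or.inr hKfin)
  have := ge_of_tendsto hlim (by filter_upwards [self_mem_nhdsWithin] with c hc using key c hc)
  refine this.trans (le_of_eq ?_)
  rw [hK, ENNReal.ofReal_mul (by positivity)]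
  ring

end Assembly

/-- Local volume bound for tubes: if `M` is a `C²` compact `d`-dimensional
submanifold of `ℝ^D` with reach `τ > 0`, `0 < σ < τ`, `y ∈ M` and `r + σ ≤ τ/8`, then
`Vol(M_σ ∩ B(y,r)) ≤ (1 + σ/τ)^d (1 + (2(r+σ)/(τ−2(r+σ)))²)^{d/2}
  Vol(B_d(0,r+σ)) Vol(B_{D−d}(0,σ))`. -/
theorem tube_local_volume_upper_bound {D d : ℕ} (hdD : d ≤ D)
    (M : C2CompactSubmanifold D d) (τ σ : ℝ)
    (hτ : 0 < τ) (hreach : reach M.carrier = τ) (hσ0 : 0 < σ) (hστ : σ < τ)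
    (y : Euc D) (hy : y ∈ M.carrier) (r : ℝ) (hr0 : 0 < r) (hr : r + σ ≤ τ / 8) :
    volume (tube M.carrier σ ∩ ball y r) ≤
      ENNReal.ofReal ((1 + σ / τ) ^ d *
          (1 + (2 * (r + σ) / (τ - 2 * (r + σ))) ^ 2) ^ ((d : ℝ) / 2)) *
        volume (ball (0 : Euc d) (r + σ)) * volume (ball (0 : Euc (D - d)) σ) := by
  have g : Good M.carrier M.tangentAt d τ := by
    refine ⟨M.isCompact, M.nonempty, hτ, ?_, M.finrank_tangent, ?_⟩
    · intro z hz x hx x' hx' h1 h2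
      rw [← hreach, reach] at hz
      obtain ⟨ρ, hρ, hzρ⟩ := exists_lt_of_lt_csSup (by
        refine ⟨0, le_refl _, fun w hw => ?_⟩
        have hw' : infDist w M.carrier < 0 := hw
        exact absurd hw' (not_lt.mpr infDist_nonneg)) hz
      exact (hρ.2 z hzρ).unique ⟨hx, h1⟩ ⟨hx', h2⟩
    · intro x hx
      obtain ⟨ε, hε, f, h1, h2, h3, h4⟩ := M.locally_graph x hx
      exact ⟨f, ε, ⟨hε, h1, h2, h3, h4⟩⟩
  have h := g.tube_ball hy hσ0 hr
  rw [finrank_euclideanSpace_fin] at h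
  exact h

end
end
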